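/- arXiv:1704.07306 — 2 statements merged into one kernel-verified Lean document; each statement's English description precedes it below -/
import Mathlib

section
/- Let M and M' be 3-connected GF(4)-representable matroids such that M' is obtained from M by relaxing a circuit-hyperplane X. Then M' has no minor isomorphic to P8⁻, F7⁼, or (F7⁼)*. -/
open Matroid Set
open scoped Classical

namespace Relax

variable {α β : Type*}

/-- A circuit of a matroid: a minimal dependent set. -/
def Circuit (M : Matroid α) (C : Set α) : Prop :=
  M.Dep C ∧ ∀ D ⊂ C, M.Indep D

/-- A hyperplane of a matroid: a maximal proper flat. -/
def Hyperplane (M : Matroid α) (H : Set α) : Prop :=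
  M.IsFlat H ∧ H ≠ M.E ∧ ∀ F, M.IsFlat F → H ⊂ F → F = M.E

/-- `X` is a circuit-hyperplane of `M`. -/
def CircuitHyperplane (M : Matroid α) (X : Set α) : Prop :=
  Circuit M X ∧ Hyperplane M X

/-- `M'` is obtained from `M` by relaxing the circuit-hyperplane `X` : the ground set is
unchanged and the bases of `M'` are exactly the bases of `M` together with `X`. -/
def IsRelaxation (M M' : Matroid α) (X : Set α) : Prop :=
  CircuitHyperplane M X ∧ M'.E = M.E ∧ ∀ B, (M'.IsBase B ↔ M.IsBase B ∨ B = X)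

/-- A matroid is representable over a field `F` if there is an assignment of vectors to its
elements under which independence coincides with linear independence. -/
def Representable (M : Matroid α) (F : Type*) [Field F] : Prop :=
  ∃ (n : ℕ) (φ : α → (Fin n → F)), ∀ I ⊆ M.E,
    (M.Indep I ↔ LinearIndependent F (fun x : I => φ (x : α)))

/-- The field GF(4). -/
abbrev GF4 := GaloisField 2 2

/-- The rank of a set in a matroid: the maximum size of an independent subset. -/
noncomputable def rk (M : Matroid α) (X : Set α) : ℕ :=
  sSup {n | ∃ I, M.Indep I ∧ I ⊆ X ∧ I.ncard = n}

/-- Deletion of a set of elements. -/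
def delete (M : Matroid α) (D : Set α) : Matroid α := M ↾ (M.E \ D)

/-- Contraction of a set of elements. -/
def contract (M : Matroid α) (C : Set α) : Matroid α := (delete M✶ C)✶

/-- `N` is a minor of `M`. -/
def MinorOf (N M : Matroid α) : Prop :=
  ∃ C D, C ⊆ M.E ∧ D ⊆ M.E ∧ Disjoint C D ∧ N = delete (contract M C) D

/-- Isomorphism of matroids. -/
def Iso (M : Matroid α) (N : Matroid β) : Prop :=
  ∃ e : M.E ≃ N.E, ∀ I : Set M.E,
    M.Indep ((↑) '' I) ↔ N.Indep ((↑) '' (e '' I))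

/-- `M` has a minor isomorphic to `N`. -/
def HasMinorIso (M : Matroid α) (N : Matroid β) : Prop :=
  ∃ M₀ : Matroid α, MinorOf M₀ M ∧ Iso M₀ N

/-- `M` has a minor isomorphic to a member of the set `𝒩` of matroids. -/
def HasMinorIn (M : Matroid α) (𝒩 : Set (Matroid β)) : Prop :=
  ∃ N ∈ 𝒩, HasMinorIso M N

/-- `M` is `𝒩`-fragile. -/
def Fragile (M : Matroid α) (𝒩 : Set (Matroid β)) : Prop :=
  HasMinorIn M 𝒩 ∧
    ∀ a ∈ M.E, ¬ (HasMinorIn (delete M {a}) 𝒩 ∧ HasMinorIn (contract M {a}) 𝒩)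

/-- `M` is (isomorphic to) the uniform matroid `U_{r,n}`. -/
def IsUniform (M : Matroid α) (r n : ℕ) : Prop :=
  M.E.Finite ∧ M.E.ncard = n ∧ ∀ I ⊆ M.E, (M.Indep I ↔ I.ncard ≤ r)

/-- `M` has a minor isomorphic to `U_{r,n}`. -/
def HasUnifMinor (M : Matroid α) (r n : ℕ) : Prop :=
  ∃ M₀, MinorOf M₀ M ∧ IsUniform M₀ r n

/-- `M` has a `{U_{2,5}, U_{3,5}}`-minor. -/
def HasU25U35Minor (M : Matroid α) : Prop :=
  HasUnifMinor M 2 5 ∨ HasUnifMinor M 3 5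

/-- `M` is `U_{2,4}`-fragile. -/
def FragileU24 (M : Matroid α) : Prop :=
  HasUnifMinor M 2 4 ∧
    ∀ a ∈ M.E, ¬ (HasUnifMinor (delete M {a}) 2 4 ∧ HasUnifMinor (contract M {a}) 2 4)

/-- `M` is `{U_{2,5}, U_{3,5}}`-fragile. -/
def FragileU25U35 (M : Matroid α) : Prop :=
  HasU25U35Minor M ∧
    ∀ a ∈ M.E, ¬ (HasU25U35Minor (delete M {a}) ∧ HasU25U35Minor (contract M {a}))

/-- A loop. -/
def Loop (M : Matroid α) (x : α) : Prop := x ∈ M.E ∧ ¬ M.Indep {x}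

/-- Two distinct non-loop elements are parallel if they form a two-element circuit. -/
def Parallel (M : Matroid α) (x y : α) : Prop := x ≠ y ∧ Circuit M {x, y}

/-- A parallel class: a maximal set of pairwise-parallel non-loop elements. -/
def ParallelClass (M : Matroid α) (A : Set α) : Prop :=
  A ⊆ M.E ∧ (∀ x ∈ A, ¬ Loop M x) ∧
    (∀ x ∈ A, ∀ y ∈ A, x ≠ y → Parallel M x y) ∧
    (∀ B, A ⊆ B → B ⊆ M.E → (∀ x ∈ B, ¬ Loop M x) →
      (∀ x ∈ B, ∀ y ∈ B, x ≠ y → Parallel M x y) → B = A)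

/-- A series class: a parallel class of the dual. -/
def SeriesClass (M : Matroid α) (A : Set α) : Prop := ParallelClass M✶ A

/-- A matroid is connected if every two distinct elements lie in a common circuit. -/
def Connected (M : Matroid α) : Prop :=
  ∀ x ∈ M.E, ∀ y ∈ M.E, x ≠ y → ∃ C, Circuit M C ∧ x ∈ C ∧ y ∈ C

/-- A `k`-separation of `M`. -/
def Separation (M : Matroid α) (k : ℕ) (A B : Set α) : Prop :=
  A ∪ B = M.E ∧ Disjoint A B ∧ k ≤ A.ncard ∧ k ≤ B.ncard ∧
    rk M A + rk M B ≤ rk M M.E + (k - 1)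

/-- A matroid is 3-connected if it is connected and has no 2-separation. -/
def ThreeConnected (M : Matroid α) : Prop :=
  Connected M ∧ ∀ A B, ¬ Separation M 2 A B

/-- `M` is 3-connected up to series and parallel classes. -/
def ThreeConnUpToSP (M : Matroid α) : Prop :=
  Connected M ∧ ∀ A B, Separation M 2 A B →
    (SeriesClass M A ∨ ParallelClass M A ∨ SeriesClass M B ∨ ParallelClass M B)

/-- A 3-separating set of `M`. -/
def ThreeSeparating (M : Matroid α) (Y : Set α) : Prop :=
  Y ⊆ M.E ∧ rk M Y + rk M (M.E \ Y) ≤ rk M M.E + 2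

/-- `M` has path width 3: there is an ordering of the ground set all of whose initial
segments are 3-separating. -/
def PathWidth3 (M : Matroid α) : Prop :=
  ∃ (n : ℕ) (e : Fin n → α), Function.Injective e ∧ Set.range e = M.E ∧
    ∀ t : Fin n, ThreeSeparating M (e '' {i | i ≤ t})

/-- A segment: every 3-element subset is a triangle. -/
def Segment (M : Matroid α) (S : Set α) : Prop :=
  S ⊆ M.E ∧ ∀ T ⊆ S, T.ncard = 3 → Circuit M T

/-- A triangle: a 3-element circuit. -/
def Triangle (M : Matroid α) (S : Set α) : Prop := Circuit M S ∧ S.ncard = 3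

/-! ### Reduced representations `[I | C]` with `C = [[A, 1], [1ᵀ, w]]` -/

/-- The column, indexed by `x`, of the matrix `[I | C]` whose rows are indexed by
`(X \ {e}) ∪ {f}`, where `C` is the block matrix `[[A, 1], [1ᵀ, w]]` with row block `X \ {e}`,
column block `(E \ X) \ {f}`, last column `e`, last row `f`, and corner entry `w`. -/
noncomputable def colVec (X : Set α) (e f : α) (A : α → α → GF4) (w : GF4) :
    α → ((X \ {e} ∪ {f} : Set α) → GF4) := fun x r =>
  if x ∈ X \ {e} ∪ ({f} : Set α) then (if (r : α) = x then 1 else 0)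
  else if (r : α) = f then (if x = e then w else 1)
  else if x = e then 1 else A (r : α) x

/-- `M = M[I | C]` where `C` is the block matrix `[[A, 1], [1ᵀ, w]]` relative to the
basis `(X \ {e}) ∪ {f}`. -/
def RepBy (M : Matroid α) (X : Set α) (e f : α) (A : α → α → GF4) (w : GF4) : Prop :=
  ∀ I ⊆ M.E, (M.Indep I ↔
    LinearIndependent GF4 (fun x : I => colVec X e f A w (x : α)))

/-- The matrix `B`, with rows restricted to `R` and columns restricted to `K`, has an
`m × n` submatrix (up to permuting rows and columns) equal to the pattern `P`. -/
def HasPattern {m n : ℕ} (B : α → α → GF4) (R K : Set α) (P : Fin m → Fin n → GF4) : Prop :=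
  ∃ (r : Fin m → α) (c : Fin n → α), Function.Injective r ∧ Function.Injective c ∧
    (∀ i, r i ∈ R) ∧ (∀ j, c j ∈ K) ∧ ∀ i j, B (r i) (c j) = P i j

/-- One non-zero element of GF(4). -/
def NZ1 (x : GF4) : Prop := x ≠ 0

/-- Two distinct non-zero elements of GF(4). -/
def NZ2 (x y : GF4) : Prop := x ≠ 0 ∧ y ≠ 0 ∧ x ≠ y

/-- Three distinct non-zero elements of GF(4). -/
def NZ3 (x y z : GF4) : Prop :=
  x ≠ 0 ∧ y ≠ 0 ∧ z ≠ 0 ∧ x ≠ y ∧ x ≠ z ∧ y ≠ z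

/-- `B` (with rows from `R` and columns from `K`) contains one of the fifteen forbidden
submatrices, up to permuting rows and columns, where `x, y, z` denote distinct non-zero
elements of GF(4). -/
def HasForbidden (B : α → α → GF4) (R K : Set α) : Prop :=
  (∃ x y z, NZ3 x y z ∧ HasPattern B R K ![![x, y, z]]) ∨
  (∃ x y, NZ2 x y ∧ HasPattern B R K ![![x, y], ![0, x]]) ∨
  (∃ x y, NZ2 x y ∧ HasPattern B R K ![![x, y], ![y, x]]) ∨
  (∃ x y z, NZ3 x y z ∧ HasPattern B R K ![![x, y], ![z, x]]) ∨
  (∃ x y z, NZ3 x y z ∧ HasPattern B R K ![![x, x], ![y, z]]) ∨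
  (∃ x, NZ1 x ∧ HasPattern B R K ![![x, x, 0], ![x, 0, x]]) ∨
  (∃ x y, NZ2 x y ∧ HasPattern B R K ![![x, x, 0], ![x, 0, y]]) ∨
  (∃ x y, NZ2 x y ∧ HasPattern B R K ![![x, x, 0], ![y, 0, y]]) ∨
  (∃ x y, NZ2 x y ∧ HasPattern B R K ![![x, y, 0], ![x, 0, y]]) ∨
  (∃ x y z, NZ3 x y z ∧ HasPattern B R K ![![x, 0, 0], ![0, y, z]]) ∨
  (∃ x, NZ1 x ∧ HasPattern B R K ![![x, 0, 0], ![0, x, 0], ![0, 0, x]]) ∨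
  (∃ x y, NZ2 x y ∧ HasPattern B R K ![![x, 0, 0], ![0, x, 0], ![0, 0, y]]) ∨
  (∃ x y z, NZ3 x y z ∧ HasPattern B R K ![![x, 0, 0], ![0, y, 0], ![0, 0, z]]) ∨
  (∃ x y, NZ2 x y ∧ HasPattern B R K ![![x, y, x], ![y, y, 0], ![x, 0, 0]]) ∨
  (∃ x y z, NZ3 x y z ∧ HasPattern B R K ![![x, y, x], ![y, y, 0], ![x, 0, z]])

/-! ### The matroids `P₈⁻`, `F₇⁼` and its dual -/

/-- The columns of the GF(3)-matrix `[I₄ | A]` representing `P₈`, where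
`A = [[0,1,1,-1],[1,0,1,1],[1,1,0,1],[-1,1,1,0]]`. -/
def P8cols : Fin 8 → Fin 4 → ZMod 3 :=
  ![![1, 0, 0, 0], ![0, 1, 0, 0], ![0, 0, 1, 0], ![0, 0, 0, 1],
    ![0, 1, 1, -1], ![1, 0, 1, 1], ![1, 1, 0, 1], ![-1, 1, 1, 0]]

/-- `M` is isomorphic to `P₈`. -/
def IsP8 (M : Matroid α) : Prop :=
  ∃ g : α → Fin 8, Set.BijOn g M.E Set.univ ∧
    ∀ I ⊆ M.E, (M.Indep I ↔ LinearIndependent (ZMod 3) (fun x : I => P8cols (g (x : α))))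

/-- `M` is isomorphic to `P₈⁻`: it is obtained from a copy of `P₈` by relaxing one of its
pair of disjoint circuit-hyperplanes. -/
def IsP8Minus (M : Matroid α) : Prop :=
  ∃ (N : Matroid α) (X Y : Set α), IsP8 N ∧ CircuitHyperplane N Y ∧ Disjoint X Y ∧
    IsRelaxation N M X

/-- The columns of the rational matrix representing the non-Fano matroid `F₇⁻`: the seven
non-zero `{0,1}`-vectors of length 3. -/
def F7cols : Fin 7 → Fin 3 → ℚ :=
  ![![1, 0, 0], ![0, 1, 0], ![0, 0, 1], ![1, 1, 0], ![1, 0, 1], ![0, 1, 1], ![1, 1, 1]]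

/-- `M` is isomorphic to the non-Fano matroid `F₇⁻`. -/
def IsF7Minus (M : Matroid α) : Prop :=
  ∃ g : α → Fin 7, Set.BijOn g M.E Set.univ ∧
    ∀ I ⊆ M.E, (M.Indep I ↔ LinearIndependent ℚ (fun x : I => F7cols (g (x : α))))

/-- `M` is isomorphic to `F₇⁼`: it is obtained from a copy of `F₇⁻` by relaxing a
circuit-hyperplane. -/
def IsF7Eq (M : Matroid α) : Prop :=
  ∃ (N : Matroid α) (X : Set α), IsF7Minus N ∧ IsRelaxation N M X

end Relax

section Coordinates

variable {α K V : Type*} [Field K] [AddCommGroup V] [Module K V]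

/-- Independence after a basis exchange, in terms of coordinates with respect to the basis. -/
lemma linearIndepOn_exchange_iff {v : α → V} {X P Q : Finset α} {T : α → α → K}
    (hX : LinearIndepOn K v (X : Set α)) (hP : P ⊆ X) (hQ : Disjoint X Q)
    (hT : ∀ y ∈ Q, v y = ∑ x ∈ X, T x y • v x) :
    LinearIndepOn K v ((X \ P ∪ Q : Finset α) : Set α) ↔
      ∀ c : α → K, (∀ x ∈ P, ∑ y ∈ Q, c y * T x y = 0) → ∀ y ∈ Q, c y = 0 := by
  have hd : Disjoint (X \ P) Q := hQ.mono_left Finset.sdiff_subset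
  rw [linearIndepOn_finset_iff] at hX ⊢
  have key : ∀ f : α → K, ∑ z ∈ X \ P ∪ Q, f z • v z =
      ∑ x ∈ X, ((if x ∈ P then 0 else f x) + ∑ y ∈ Q, f y * T x y) • v x := by
    intro f
    rw [Finset.sum_union hd]
    simp_rw [add_smul, Finset.sum_add_distrib, Finset.sum_smul]
    congr 1
    · rw [← Finset.sum_sdiff hP, Finset.sum_eq_zero (s := P), add_zero]
      · exact Finset.sum_congr rfl fun x hx => by rw [if_neg (Finset.mem_sdiff.1 hx).2]
      · intro x hx
        rw [if_pos hx, zero_smul]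
    · rw [Finset.sum_comm]
      refine Finset.sum_congr rfl fun y hy => ?_
      rw [hT y hy, Finset.smul_sum]
      simp_rw [mul_smul]
  constructor
  · intro h c hc y hy
    have := h (fun z => if z ∈ Q then c z else - ∑ y ∈ Q, c y * T z y) ?_ y
      (Finset.mem_union_right _ hy)
    · simpa [hy] using this
    rw [key]
    refine Finset.sum_eq_zero fun x hx => ?_
    have hxQ : x ∉ Q := Finset.disjoint_left.1 hQ hx
    have e : ∑ y ∈ Q, (if y ∈ Q then c y else - ∑ y' ∈ Q, c y' * T y y') * T x y =
        ∑ y ∈ Q, c y * T x y := Finset.sum_congr rfl fun y hy => by rw [if_pos hy]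
    rw [e]
    by_cases hxP : x ∈ P
    · simp [hxP, hc x hxP]
    · simp [hxP, hxQ]
  · intro h f hf
    rw [key] at hf
    have h0 := hX _ hf
    have hfQ : ∀ y ∈ Q, f y = 0 := h f fun x hx => by simpa [hx] using h0 x (hP hx)
    intro z hz
    rcases Finset.mem_union.1 hz with hz | hz
    · have h1 := h0 z (Finset.mem_sdiff.1 hz).1
      rw [if_neg (Finset.mem_sdiff.1 hz).2, Finset.sum_eq_zero, add_zero] at h1
      · exact h1
      · intro y hy
        rw [hfQ y hy, zero_mul]
    · exact hfQ z hz

/-- Independence of an exchange of a spanning-circuit-of-a-hyperplane, in terms of affine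
coordinates. -/
lemma linearIndepOn_circuit_exchange_iff {v : α → V} {X P Q : Finset α} {a : α → α → K}
    {v₀ : V} {l : V →ₗ[K] K} (hsum : ∑ x ∈ X, v x = 0)
    (hX : ∀ x ∈ X, LinearIndepOn K v ((X.erase x : Finset α) : Set α))
    (hl : ∀ x ∈ X, l (v x) = 0) (hl₀ : l v₀ = 1)
    (hP : P ⊆ X) (hPne : P.Nonempty) (hQ : Disjoint X Q)
    (ha : ∀ y ∈ Q, v y = v₀ + ∑ x ∈ X, a x y • v x) :
    LinearIndepOn K v ((X \ P ∪ Q : Finset α) : Set α) ↔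
      ∀ c : α → K, ∑ y ∈ Q, c y = 0 →
        (∀ x ∈ P, ∀ x' ∈ P, ∑ y ∈ Q, c y * a x y = ∑ y ∈ Q, c y * a x' y) →
        ∀ y ∈ Q, c y = 0 := by
  have hd : Disjoint (X \ P) Q := hQ.mono_left Finset.sdiff_subset
  rw [linearIndepOn_finset_iff]
  have hconst : ∀ g : α → K, ∑ x ∈ X, g x • v x = 0 → ∀ x ∈ X, ∀ x' ∈ X, g x = g x' := by
    intro g hg x hx x' hx'
    by_cases hne : x = x'
    · rw [hne]
    have h1 := linearIndepOn_finset_iff.1 (hX x' hx') (fun z => g z - g x') ?_ x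
      (Finset.mem_erase.2 ⟨hne, hx⟩)
    · exact sub_eq_zero.1 h1
    · have h2 : ∑ z ∈ X, (g z - g x') • v z = 0 := by
        simp_rw [sub_smul, Finset.sum_sub_distrib, hg, ← Finset.smul_sum, hsum]
        simp
      rw [← Finset.add_sum_erase X _ hx'] at h2
      simpa using h2
  have key : ∀ f : α → K, ∑ z ∈ X \ P ∪ Q, f z • v z = (∑ y ∈ Q, f y) • v₀ +
      ∑ x ∈ X, ((if x ∈ P then 0 else f x) + ∑ y ∈ Q, f y * a x y) • v x := by
    intro f
    rw [Finset.sum_union hd]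
    simp_rw [add_smul, Finset.sum_add_distrib, Finset.sum_smul]
    rw [add_left_comm]
    congr 1
    · rw [← Finset.sum_sdiff hP, Finset.sum_eq_zero (s := P), add_zero]
      · exact Finset.sum_congr rfl fun x hx => by rw [if_neg (Finset.mem_sdiff.1 hx).2]
      · intro x hx
        rw [if_pos hx, zero_smul]
    · rw [Finset.sum_comm, ← Finset.sum_add_distrib]
      refine Finset.sum_congr rfl fun y hy => ?_
      rw [ha y hy, smul_add, Finset.smul_sum]
      simp_rw [mul_smul]
  have hlX : ∀ g : α → K, l (∑ x ∈ X, g x • v x) = 0 := by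
    intro g
    rw [map_sum]
    exact Finset.sum_eq_zero fun x hx => by rw [map_smul, hl x hx, smul_zero]
  constructor
  · intro h c hc0 hc y hy
    obtain ⟨p, hp⟩ := hPne
    have := h (fun z => if z ∈ Q then c z else
      (∑ y ∈ Q, c y * a p y) - ∑ y ∈ Q, c y * a z y) ?_ y (Finset.mem_union_right _ hy)
    · simpa [hy] using this
    rw [key]
    have e : ∀ x, ∑ y ∈ Q, (if y ∈ Q then c y else
        (∑ y' ∈ Q, c y' * a p y') - ∑ y' ∈ Q, c y' * a y y') * a x y =
        ∑ y ∈ Q, c y * a x y := fun x => Finset.sum_congr rfl fun y hy => by rw [if_pos hy]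
    have e' : ∑ y ∈ Q, (if y ∈ Q then c y else
        (∑ y' ∈ Q, c y' * a p y') - ∑ y' ∈ Q, c y' * a y y') = 0 := by
      rw [← hc0]
      exact Finset.sum_congr rfl fun y hy => by rw [if_pos hy]
    rw [e', zero_smul, zero_add]
    have hz : ∑ x ∈ X, (∑ y ∈ Q, c y * a p y) • v x = 0 := by
      rw [← Finset.smul_sum, hsum, smul_zero]
    refine Eq.trans ?_ hz
    refine Finset.sum_congr rfl fun x hx => ?_
    have hxQ : x ∉ Q := Finset.disjoint_left.1 hQ hx
    rw [e]
    by_cases hxP : x ∈ P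
    · simp [hxP, hc x hxP p hp]
    · simp [hxP, hxQ]
  · intro h f hf
    rw [key] at hf
    have hf0 : ∑ y ∈ Q, f y = 0 := by
      have := congrArg l hf
      rw [map_add, hlX, map_smul, hl₀, map_zero] at this
      simpa using this
    rw [hf0, zero_smul, zero_add] at hf
    have h0 := hconst _ hf
    have hfQ : ∀ y ∈ Q, f y = 0 := h f hf0 fun x hx x' hx' => by
      simpa [hx, hx'] using h0 x (hP hx) x' (hP hx')
    intro z hz
    rcases Finset.mem_union.1 hz with hz | hz
    · obtain ⟨p, hp⟩ := hPne
      have h1 := h0 z (Finset.mem_sdiff.1 hz).1 p (hP hp)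
      have hs : ∀ x, ∑ y ∈ Q, f y * a x y = 0 := fun x =>
        Finset.sum_eq_zero fun y hy => by rw [hfQ y hy, zero_mul]
      simpa [hs, hp, (Finset.mem_sdiff.1 hz).2] using h1
    · exact hfQ z hz

end Coordinates

section Coordinates

variable {α K V : Type*} [Field K] [AddCommGroup V] [Module K V]

/-- The columns indexed by `Q` of the matrix `T`, restricted to the rows `P`, are independent. -/
def ColumnsIndep (T : α → α → K) (P Q : Finset α) : Prop :=
  ∀ c : α → K, (∀ x ∈ P, ∑ y ∈ Q, c y * T x y = 0) → ∀ y ∈ Q, c y = 0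

/-- The columns indexed by `Q` of the matrix `a`, restricted to the rows `P`, are affinely
independent modulo the all-ones vector. -/
def ColumnsAffineIndep (a : α → α → K) (P Q : Finset α) : Prop :=
  ∀ c : α → K, ∑ y ∈ Q, c y = 0 →
    (∀ x ∈ P, ∀ x' ∈ P, ∑ y ∈ Q, c y * a x y = ∑ y ∈ Q, c y * a x' y) → ∀ y ∈ Q, c y = 0

lemma columnsIndep_singleton {T : α → α → K} {x y : α} :
    ColumnsIndep T {x} {y} ↔ T x y ≠ 0 := by
  constructor
  · intro h h0
    simpa using h (fun _ => 1) (by simp [h0]) y (by simp)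
  · intro h c hc y' hy'
    simp only [Finset.mem_singleton] at hy'
    subst hy'
    simpa [h] using hc

lemma columnsIndep_pair {T : α → α → K} {x x' y y' : α} (hy : y ≠ y') (h1 : T x y ≠ 0) :
    ColumnsIndep T {x, x'} {y, y'} ↔ T x y * T x' y' ≠ T x y' * T x' y := by
  constructor
  · intro h h0
    have := h (fun z => if z = y then T x y' else - T x y) (by
      simp [Finset.sum_pair hy, hy.symm]
      constructor
      · ring
      · linear_combination - h0) y' (by simp)
    simp [hy.symm, h1] at this
  · intro h c hc
    simp [Finset.sum_pair hy] at hc ⊢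
    obtain ⟨e1, e2⟩ := hc
    have h2 : c y' = 0 := by
      have : c y' * (T x y * T x' y' - T x y' * T x' y) = 0 := by
        linear_combination T x y * e2 - T x' y * e1
      simpa [sub_ne_zero.2 h] using this
    refine ⟨?_, h2⟩
    rw [h2] at e1
    simpa [h1] using e1

lemma columnsAffineIndep_pair {a : α → α → K} {x x' y y' : α} (hy : y ≠ y') :
    ColumnsAffineIndep a {x, x'} {y, y'} ↔ a x y + a x' y' - a x y' - a x' y ≠ 0 := by
  constructor
  · intro h h0
    have := h (fun z => if z = y then 1 else - 1) (by
      simp [Finset.sum_pair hy, hy.symm]) (by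
      simp [Finset.sum_pair hy, hy.symm]
      constructor
      · linear_combination h0
      · linear_combination - h0) y' (by simp)
    simp [hy.symm] at this
  · intro h c hc0 hc
    simp [Finset.sum_pair hy] at hc0 hc ⊢
    have e : c y = - c y' := by linear_combination hc0
    have h2 : c y' = 0 := by
      have : c y' * (a x y + a x' y' - a x y' - a x' y) = 0 := by
        linear_combination - hc.1 + (a x y - a x' y) * e
      simpa [h] using this
    exact ⟨by rw [e, h2, neg_zero], h2⟩

lemma ColumnsIndep.of_scaling {T T' : α → α → K} {P Q : Finset α} {r s : α → K}
    (hr : ∀ x ∈ P, r x ≠ 0) (hs : ∀ y ∈ Q, s y ≠ 0)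
    (h : ∀ x ∈ P, ∀ y ∈ Q, T' x y = r x * s y * T x y) (hT : ColumnsIndep T P Q) :
    ColumnsIndep T' P Q := by
  intro c hc y hy
  have := hT (fun y => c y * s y) (fun x hx => ?_) y hy
  · simpa [hs y hy] using this
  · have h1 := hc x hx
    have : r x * ∑ y ∈ Q, c y * s y * T x y = 0 := by
      rw [← h1, Finset.mul_sum]
      refine Finset.sum_congr rfl fun y hy => ?_
      rw [h x hx y hy]; ring
    simpa [hr x hx] using this

lemma ColumnsIndep.map {K' : Type*} [Field K'] (σ : K ≃+* K') {T : α → α → K} {P Q : Finset α}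
    (hT : ColumnsIndep T P Q) : ColumnsIndep (fun x y => σ (T x y)) P Q := by
  intro c hc y hy
  have := hT (fun y => σ.symm (c y)) (fun x hx => ?_) y hy
  · simpa using this
  · apply σ.injective
    simpa using hc x hx

lemma ColumnsAffineIndep.of_scaling {a a' : α → α → K} {P Q : Finset α} {r s : α → K} {μ : K}
    (hμ : μ ≠ 0) (h : ∀ x ∈ P, ∀ y ∈ Q, a' x y = r x + s y + μ * a x y)
    (ha : ColumnsAffineIndep a P Q) : ColumnsAffineIndep a' P Q := by
  intro c hc0 hc
  have e : ∀ x ∈ P, ∑ y ∈ Q, c y * a' x y =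
      (∑ y ∈ Q, c y * s y) + μ * ∑ y ∈ Q, c y * a x y := by
    intro x hx
    rw [← zero_add (∑ y ∈ Q, c y * s y), ← zero_mul (r x), ← hc0, Finset.sum_mul,
      Finset.mul_sum, ← Finset.sum_add_distrib, ← Finset.sum_add_distrib]
    refine Finset.sum_congr rfl fun y hy => ?_
    rw [h x hx y hy]; ring
  refine ha c hc0 fun x hx x' hx' => ?_
  have := hc x hx x' hx'
  rw [e x hx, e x' hx', add_right_inj] at this
  exact mul_left_cancel₀ hμ this

/-- A basis gives coordinates. -/
lemma exists_coordinates [FiniteDimensional K V] {v : α → V} {X : Finset α}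
    (hX : LinearIndepOn K v (X : Set α)) (hc : X.card = Module.finrank K V) (u : V) :
    ∃ c : α → K, u = ∑ x ∈ X, c x • v x := by
  have h : Submodule.span K (Set.range fun x : (X : Set α) => v x) = ⊤ :=
    LinearIndependent.span_eq_top_of_card_eq_finrank' hX (by simpa using hc)
  have h' : u ∈ Submodule.span K (v '' (X : Set α)) := by
    rw [Set.image_eq_range, h]; trivial
  obtain ⟨c, hc⟩ := (Submodule.mem_span_image_finset_iff_exists_fun' K).1 h'
  exact ⟨c, hc.symm⟩

lemma exists_coordinate_matrix [FiniteDimensional K V] {v : α → V} {X : Finset α}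
    (hX : LinearIndepOn K v (X : Set α)) (hc : X.card = Module.finrank K V) :
    ∃ T : α → α → K, ∀ y, v y = ∑ x ∈ X, T x y • v x := by
  choose T hT using fun y => exists_coordinates hX hc (v y)
  exact ⟨fun x y => T y x, hT⟩

lemma linearIndepOn_smul_iff {v : α → V} {u : α → K} {S : Set α} (hu : ∀ x ∈ S, u x ≠ 0) :
    LinearIndepOn K (fun x => u x • v x) S ↔ LinearIndepOn K v S := by
  exact LinearIndependent.units_smul_iff (fun x : S => v x) (fun x : S => Units.mk0 (u x) (hu x x.2))

/-- Normal form for a dependent set `X` all of whose exchanges with `R` are bases. -/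
lemma exists_affine_coordinates [FiniteDimensional K V] {v : α → V} {X R : Finset α}
    (hXc : X.card = Module.finrank K V) (hX : ¬ LinearIndepOn K v (X : Set α))
    (hR : R.Nonempty) (hd : Disjoint X R)
    (hexch : ∀ x ∈ X, ∀ y ∈ R,
      LinearIndepOn K v ((insert y (X.erase x) : Finset α) : Set α)) :
    ∃ a : α → α → K, ∀ P ⊆ X, P.Nonempty → ∀ Q ⊆ R,
      (LinearIndepOn K v ((X \ P ∪ Q : Finset α) : Set α) ↔ ColumnsAffineIndep a P Q) := by
  obtain ⟨y₀, hy₀⟩ := hR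
  have hXe : ∀ x ∈ X, LinearIndepOn K v ((X.erase x : Finset α) : Set α) := fun x hx =>
    (hexch x hx y₀ hy₀).mono (by simp [Finset.coe_insert])
  obtain ⟨c, hc, x₁, hx₁, hcx₁⟩ := not_linearIndepOn_finset_iff.1 hX
  have hc0 : ∀ x ∈ X, c x ≠ 0 := by
    intro x hx h0
    rw [← Finset.add_sum_erase X _ hx, h0, zero_smul, zero_add] at hc
    have hne : x₁ ≠ x := by rintro rfl; exact hcx₁ h0
    exact hcx₁ (linearIndepOn_finset_iff.1 (hXe x hx) c hc x₁ (Finset.mem_erase.2 ⟨hne, hx₁⟩))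
  have hcard : ∀ x ∈ X, ∀ y ∈ R, (insert y (X.erase x)).card = Module.finrank K V := by
    intro x hx y hy
    have hyX : y ∉ X.erase x := fun h =>
      Finset.disjoint_right.1 hd hy (Finset.mem_of_mem_erase h)
    rw [Finset.card_insert_of_notMem hyX, Finset.card_erase_add_one hx, hXc]
  have hy₀X : y₀ ∉ ((X.erase x₁ : Finset α) : Set α) := fun h =>
      Finset.disjoint_right.1 hd hy₀ (Finset.mem_of_mem_erase h)
  have hns : v y₀ ∉ Submodule.span K (v '' ((X.erase x₁ : Finset α) : Set α)) := by
    have := hexch x₁ hx₁ y₀ hy₀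
    rw [Finset.coe_insert, linearIndepOn_insert hy₀X] at this
    exact this.2
  obtain ⟨l, hl₀, hl⟩ := Submodule.exists_le_ker_of_notMem hns
  have hlX : ∀ x ∈ X, l (v x) = 0 := by
    have h1 : ∀ x ∈ X.erase x₁, l (v x) = 0 := fun x hx =>
      hl (Submodule.subset_span ⟨x, hx, rfl⟩)
    intro x hx
    by_cases h : x = x₁
    · subst h
      have := congrArg l hc
      rw [← Finset.add_sum_erase X _ hx, map_add, map_sum, Finset.sum_eq_zero, map_smul] at this
      · simpa [hc0 x hx] using this
      · intro z hz
        rw [map_smul, h1 z hz, smul_zero]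
    · exact h1 x (Finset.mem_erase.2 ⟨h, hx⟩)
  have hlR : ∀ y ∈ R, l (v y) ≠ 0 := by
    intro y hy h0
    obtain ⟨d, hd'⟩ := exists_coordinates (hexch x₁ hx₁ y hy) (hcard x₁ hx₁ y hy) (v y₀)
    apply hl₀
    rw [hd', map_sum]
    refine Finset.sum_eq_zero fun z hz => ?_
    rw [map_smul]
    rcases Finset.mem_insert.1 hz with rfl | hz
    · rw [h0, smul_zero]
    · rw [hlX z (Finset.mem_of_mem_erase hz), smul_zero]
  set u : α → K := fun z => if z ∈ X then c z else (l (v z))⁻¹ with hu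
  have huX : ∀ x ∈ X, u x = c x := fun x hx => by simp [hu, hx]
  have huR : ∀ y ∈ R, u y = (l (v y))⁻¹ := fun y hy => by
    simp [hu, Finset.disjoint_right.1 hd hy]
  have hu0 : ∀ z ∈ X ∪ R, u z ≠ 0 := by
    intro z hz
    rcases Finset.mem_union.1 hz with hz | hz
    · rw [huX z hz]; exact hc0 z hz
    · rw [huR z hz]; exact inv_ne_zero (hlR z hz)
  have hlu : ∀ y ∈ R, l (u y • v y) = 1 := fun y hy => by
    rw [map_smul, huR y hy, smul_eq_mul, inv_mul_cancel₀ (hlR y hy)]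
  have hcoord : ∀ y, ∃ a : α → K, y ∈ R →
      u y • v y = u y₀ • v y₀ + ∑ x ∈ X, a x • (u x • v x) := by
    intro y
    by_cases hy : y ∈ R
    swap
    · exact ⟨0, fun h => absurd h hy⟩
    obtain ⟨d, hd'⟩ := exists_coordinates (hexch x₁ hx₁ y₀ hy₀) (hcard x₁ hx₁ y₀ hy₀)
      (u y • v y - u y₀ • v y₀)
    rw [Finset.sum_insert hy₀X] at hd'
    have h1 := congrArg l hd'
    rw [map_add, map_sum, Finset.sum_eq_zero, map_sub, hlu y hy, hlu y₀ hy₀, sub_self, add_zero,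
      map_smul, smul_eq_mul] at h1
    · have hd0 : d y₀ = 0 := by simpa [hl₀] using h1.symm
      rw [hd0, zero_smul, zero_add] at hd'
      refine ⟨fun x => if x = x₁ then 0 else d x * (u x)⁻¹, fun _ => ?_⟩
      rw [← Finset.add_sum_erase X _ hx₁]
      beta_reduce
      rw [if_pos rfl, zero_smul, zero_add,
        ← sub_eq_iff_eq_add', hd']
      refine Finset.sum_congr rfl fun x hx => ?_
      rw [if_neg (Finset.ne_of_mem_erase hx), smul_smul, mul_assoc, inv_mul_cancel₀, mul_one]
      exact hu0 x (Finset.mem_union_left _ (Finset.mem_of_mem_erase hx))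
    · intro z hz
      rw [map_smul, hlX z (Finset.mem_of_mem_erase hz), smul_zero]
  choose a ha using hcoord
  refine ⟨fun x y => a y x, fun P hP hPne Q hQ => ?_⟩
  rw [← linearIndepOn_smul_iff (u := u)]
  · exact linearIndepOn_circuit_exchange_iff (v := fun x => u x • v x) (v₀ := u y₀ • v y₀) (l := l)
      (by rw [← hc]; exact Finset.sum_congr rfl fun x hx => by rw [huX x hx])
      (fun x hx => (linearIndepOn_smul_iff (fun z hz => hu0 z
        (Finset.mem_union_left _ (Finset.mem_of_mem_erase hz)))).2 (hXe x hx))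
      (fun x hx => by rw [map_smul, hlX x hx, smul_zero]) (hlu y₀ hy₀) hP hPne
      (hd.mono_right hQ) (fun y hy => ha y (hQ hy))
  · intro z hz
    apply hu0
    rcases Finset.mem_union.1 hz with hz | hz
    · exact Finset.mem_union_left _ (Finset.mem_sdiff.1 hz).1
    · exact Finset.mem_union_right _ (hQ hz)

end Coordinates

section Curvature

variable {α A : Type*}

/-- The additive cross ratio of the `2 × 2` submatrix with rows `x, u` and columns `y, v`. -/
def curv [AddCommGroup A] (s : α → α → A) (x u y v : α) : A :=
  s x y + s u v - s x v - s u y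

/-- The matrix `s`, normalised to vanish on the row `x₀` and the column `y₀`. -/
lemma curv_normalize [AddCommGroup A] (s : α → α → A) (x₀ y₀ x x' y y' : α) :
    curv s x₀ x y₀ y + curv s x₀ x' y₀ y' - curv s x₀ x y₀ y' - curv s x₀ x' y₀ y =
      curv s x x' y y' := by
  unfold curv; abel

set_option synthInstance.maxSize 4000 in
set_option synthInstance.maxHeartbeats 400000 in
lemma curv_four_zmod_three : ∀ a b c d a' b' c' d' : ZMod 3, (a = 0 ↔ a' = 0) → (b = 0 ↔ b' = 0) →
    (c = 0 ↔ c' = 0) → (d = 0 ↔ d' = 0) → (a = b ↔ a' = b') → (c = d ↔ c' = d') →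
    (a = c ↔ a' = c') → (b = d ↔ b' = d') → (a + d - b - c = 0 ↔ a' + d' - b' - c' = 0) →
    (a' = a ∧ d' = d) ∨ (a' = -a ∧ d' = -d) := by
  decide +kernel

/-- Over `ZMod 3`, the zero set of the cross ratio determines a matrix up to sign, row shifts and
column shifts. -/
lemma exists_shift_of_curv_iff {s s' : α → α → ZMod 3} {R Q : Finset α}
    (h : ∀ x ∈ R, ∀ x' ∈ R, ∀ y ∈ Q, ∀ y' ∈ Q, x ≠ x' → y ≠ y' →
      (curv s x x' y y' = 0 ↔ curv s' x x' y y' = 0)) :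
    ∃ p q : α → ZMod 3, (∀ x ∈ R, ∀ y ∈ Q, s' x y = p x + q y + s x y) ∨
      (∀ x ∈ R, ∀ y ∈ Q, s' x y = p x + q y - s x y) := by
  have h' : ∀ x ∈ R, ∀ x' ∈ R, ∀ y ∈ Q, ∀ y' ∈ Q,
      (curv s x x' y y' = 0 ↔ curv s' x x' y y' = 0) := by
    intro x hx x' hx' y hy y' hy'
    by_cases h1 : x = x'
    · subst h1; simp [curv]
    by_cases h2 : y = y'
    · subst h2; simp [curv]
    exact h x hx x' hx' y hy y' hy' h1 h2
  rcases R.eq_empty_or_nonempty with rfl | ⟨x₀, hx₀⟩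
  · exact ⟨0, 0, by simp⟩
  rcases Q.eq_empty_or_nonempty with rfl | ⟨y₀, hy₀⟩
  · exact ⟨0, 0, by simp⟩
  have two : ∀ t : α → α → ZMod 3, ∀ x y y', curv t x₀ x y₀ y = curv t x₀ x y₀ y' ↔
      curv t x₀ x y y' = 0 := by
    intro t x y y'
    unfold curv
    constructor <;> intro h <;> linear_combination -h
  have two' : ∀ t : α → α → ZMod 3, ∀ x x' y, curv t x₀ x y₀ y = curv t x₀ x' y₀ y ↔
      curv t x x' y₀ y = 0 := by
    intro t x y y'
    unfold curv
    constructor <;> intro h <;> linear_combination -h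
  have key : ∀ x ∈ R, ∀ x' ∈ R, ∀ y ∈ Q, ∀ y' ∈ Q,
      (curv s' x₀ x y₀ y = curv s x₀ x y₀ y ∧ curv s' x₀ x' y₀ y' = curv s x₀ x' y₀ y') ∨
      (curv s' x₀ x y₀ y = - curv s x₀ x y₀ y ∧
        curv s' x₀ x' y₀ y' = - curv s x₀ x' y₀ y') := by
    intro x hx x' hx' y hy y' hy'
    apply curv_four_zmod_three _ (curv s x₀ x y₀ y') (curv s x₀ x' y₀ y) _ _
      (curv s' x₀ x y₀ y') (curv s' x₀ x' y₀ y)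
    · exact h' _ hx₀ _ hx _ hy₀ _ hy
    · exact h' _ hx₀ _ hx _ hy₀ _ hy'
    · exact h' _ hx₀ _ hx' _ hy₀ _ hy
    · exact h' _ hx₀ _ hx' _ hy₀ _ hy'
    · rw [two, two]; exact h' _ hx₀ _ hx _ hy _ hy'
    · rw [two, two]; exact h' _ hx₀ _ hx' _ hy _ hy'
    · rw [two', two']; exact h' _ hx _ hx' _ hy₀ _ hy
    · rw [two', two']; exact h' _ hx _ hx' _ hy₀ _ hy'
    · rw [curv_normalize, curv_normalize]; exact h' _ hx _ hx' _ hy _ hy'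
  by_cases hall : ∀ x ∈ R, ∀ y ∈ Q, curv s' x₀ x y₀ y = curv s x₀ x y₀ y
  · refine ⟨fun x => s' x y₀ - s x y₀ - s' x₀ y₀ + s x₀ y₀, fun y => s' x₀ y - s x₀ y, Or.inl ?_⟩
    intro x hx y hy
    have := hall x hx y hy
    unfold curv at this
    linear_combination this
  · push Not at hall
    obtain ⟨x, hx, y, hy, hne⟩ := hall
    refine ⟨fun x => s' x y₀ + s x y₀ - s' x₀ y₀ - s x₀ y₀, fun y => s' x₀ y + s x₀ y, Or.inr ?_⟩
    intro x' hx' y' hy'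
    rcases key x hx x' hx' y hy y' hy' with h1 | h1
    · exact absurd h1.1 hne
    · have := h1.2
      unfold curv at this
      linear_combination this


variable {K : Type*} [Field K] [CharP K 2]

/-- In characteristic two, a matrix whose cross ratio vanishes according to a sign pattern
has at most one nonzero normalised entry. -/
lemma curv_eq_of_sign {T : α → α → ZMod 3} {a : α → α → K} {R Q : Finset α} {x₀ y₀ : α}
    (hx₀ : x₀ ∈ R) (hy₀ : y₀ ∈ Q) (hT : ∀ x ∈ R, ∀ y ∈ Q, T x y ≠ 0)
    (h : ∀ x ∈ R, ∀ x' ∈ R, ∀ y ∈ Q, ∀ y' ∈ Q,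
      (curv a x x' y y' = 0 ↔ T x y * T x' y' = T x y' * T x' y))
    {x x' y y' : α} (hx : x ∈ R) (hx' : x' ∈ R) (hy : y ∈ Q) (hy' : y' ∈ Q)
    (h1 : curv a x₀ x y₀ y ≠ 0) (h2 : curv a x₀ x' y₀ y' ≠ 0) :
    curv a x₀ x y₀ y = curv a x₀ x' y₀ y' := by
  have hk : (2 : K) = 0 := CharP.cast_eq_zero K 2
  have hsgn : ∀ t : ZMod 3, t ≠ 0 → t * t = 1 := by decide
  have hsgn' : ∀ t : ZMod 3, t ≠ 0 → t = 1 ∨ t = -1 := by decide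
  set τ : α → α → ZMod 3 := fun x y => T x y * T x₀ y₀ * (T x₀ y * T x y₀) with hτ
  have hτ0 : ∀ x ∈ R, ∀ y ∈ Q, τ x y ≠ 0 := fun x hx y hy =>
    mul_ne_zero (mul_ne_zero (hT _ hx _ hy) (hT _ hx₀ _ hy₀))
      (mul_ne_zero (hT _ hx₀ _ hy) (hT _ hx _ hy₀))
  have hcr : ∀ x ∈ R, ∀ x' ∈ R, ∀ y ∈ Q, ∀ y' ∈ Q,
      (T x y * T x' y' = T x y' * T x' y ↔ τ x y * τ x' y' = τ x y' * τ x' y) := by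
    intro x hx x' hx' y hy y' hy'
    have e : T x₀ y₀ * T x₀ y₀ * (T x₀ y * T x₀ y' * T x y₀ * T x' y₀) ≠ 0 := by
      simp [hT _ hx₀ _ hy₀, hT _ hx₀ _ hy, hT _ hx₀ _ hy', hT _ hx _ hy₀, hT _ hx' _ hy₀]
    constructor
    · intro e1
      simp only [hτ]
      linear_combination (T x₀ y₀ * T x₀ y₀ * (T x₀ y * T x₀ y' * T x y₀ * T x' y₀)) * e1
    · intro e1
      refine mul_left_cancel₀ e ?_
      simp only [hτ] at e1
      linear_combination e1
  have hn : ∀ x ∈ R, ∀ y ∈ Q, (curv a x₀ x y₀ y = 0 ↔ τ x y = 1) := by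
    intro x hx y hy
    rw [h _ hx₀ _ hx _ hy₀ _ hy]
    have := hsgn (T x y * T x₀ y₀) (mul_ne_zero (hT _ hx _ hy) (hT _ hx₀ _ hy₀))
    constructor
    · intro e
      simp only [hτ]
      rw [← e, ← this]; ring
    · intro e
      simp only [hτ] at e
      have := congrArg (T x y * T x₀ y₀ * ·) e
      simp only [← mul_assoc, mul_one] at this
      rw [mul_comm, ← this]
      linear_combination (T x₀ y * T x y₀) * hsgn (T x y * T x₀ y₀)
        (mul_ne_zero (hT _ hx _ hy) (hT _ hx₀ _ hy₀))
  have four : ∀ x ∈ R, ∀ x' ∈ R, ∀ y ∈ Q, ∀ y' ∈ Q, τ x y * τ x' y' = τ x y' * τ x' y →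
      curv a x₀ x y₀ y + curv a x₀ x' y₀ y' - curv a x₀ x y₀ y' - curv a x₀ x' y₀ y = 0 := by
    intro x hx x' hx' y hy y' hy' e
    rw [curv_normalize, h _ hx _ hx' _ hy _ hy', hcr _ hx _ hx' _ hy _ hy']
    exact e
  have n0 : ∀ y, curv a x₀ x₀ y₀ y = 0 := by intro y; simp [curv]
  have n0' : ∀ x, curv a x₀ x y₀ y₀ = 0 := by intro y; simp [curv]
  have t0 : ∀ y ∈ Q, τ x₀ y = 1 := fun y hy => (hn _ hx₀ _ hy).1 (n0 y)
  have t0' : ∀ x ∈ R, τ x y₀ = 1 := fun x hx => (hn _ hx _ hy₀).1 (n0' x)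
  have row : ∀ x ∈ R, ∀ y ∈ Q, ∀ y' ∈ Q, τ x y = τ x y' →
      curv a x₀ x y₀ y = curv a x₀ x y₀ y' := by
    intro x hx y hy y' hy' e
    have := four x hx x₀ hx₀ y hy y' hy' (by rw [t0 _ hy, t0 _ hy', e])
    rw [n0, n0] at this
    linear_combination this
  have col : ∀ x ∈ R, ∀ x' ∈ R, ∀ y ∈ Q, τ x y = τ x' y →
      curv a x₀ x y₀ y = curv a x₀ x' y₀ y := by
    intro x hx x' hx' y hy e
    have := four x hx x' hx' y hy y₀ hy₀ (by rw [t0' _ hx, t0' _ hx', e, mul_comm])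
    rw [n0', n0'] at this
    linear_combination this
  have htri : ∀ b d : ZMod 3, b ≠ 0 → d ≠ 0 → b ≠ 1 → d ≠ 1 → b = d := by decide
  have hA := hτ0 _ hx _ hy
  have hD := hτ0 _ hx' _ hy'
  have hA1 : τ x y ≠ 1 := fun e => h1 ((hn _ hx _ hy).2 e)
  have hD1 : τ x' y' ≠ 1 := fun e => h2 ((hn _ hx' _ hy').2 e)
  have hAD := htri _ _ hA hD hA1 hD1
  by_cases hB : τ x y' = 1
  · by_cases hC : τ x' y = 1
    · have e := four x hx x' hx' y hy y' hy' (by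
        rw [hB, hC, hAD]; simpa using hsgn _ hD)
      rw [(hn _ hx _ hy').2 hB, (hn _ hx' _ hy).2 hC] at e
      linear_combination e - curv a x₀ x' y₀ y' * hk
    · have e := htri _ _ hA (hτ0 _ hx' _ hy) hA1 hC
      rw [col _ hx _ hx' _ hy e, row _ hx' _ hy _ hy' (e.symm.trans hAD)]
  · have e := htri _ _ hA (hτ0 _ hx _ hy') hA1 hB
    rw [row _ hx _ hy _ hy' e, col _ hx _ hx' _ hy' (e.symm.trans hAD)]

lemma exists_scaled_shift_of_sign {T : α → α → ZMod 3} {a a' : α → α → K} {R Q : Finset α}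
    (hT : ∀ x ∈ R, ∀ y ∈ Q, T x y ≠ 0)
    (h : ∀ x ∈ R, ∀ x' ∈ R, ∀ y ∈ Q, ∀ y' ∈ Q, x ≠ x' → y ≠ y' →
      (curv a x x' y y' = 0 ↔ T x y * T x' y' = T x y' * T x' y))
    (h' : ∀ x ∈ R, ∀ x' ∈ R, ∀ y ∈ Q, ∀ y' ∈ Q, x ≠ x' → y ≠ y' →
      (curv a' x x' y y' = 0 ↔ T x y * T x' y' = T x y' * T x' y)) :
    ∃ (p q : α → K) (μ : K), μ ≠ 0 ∧ ∀ x ∈ R, ∀ y ∈ Q, a' x y = p x + q y + μ * a x y := by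
  have ext : ∀ b : α → α → K, (∀ x ∈ R, ∀ x' ∈ R, ∀ y ∈ Q, ∀ y' ∈ Q, x ≠ x' → y ≠ y' →
      (curv b x x' y y' = 0 ↔ T x y * T x' y' = T x y' * T x' y)) →
      ∀ x ∈ R, ∀ x' ∈ R, ∀ y ∈ Q, ∀ y' ∈ Q,
      (curv b x x' y y' = 0 ↔ T x y * T x' y' = T x y' * T x' y) := by
    intro b h x hx x' hx' y hy y' hy'
    by_cases h1 : x = x'
    · subst h1; simp [curv, mul_comm]
    by_cases h2 : y = y'
    · subst h2; simp [curv]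
    exact h x hx x' hx' y hy y' hy' h1 h2
  replace h := ext a h
  replace h' := ext a' h'
  rcases R.eq_empty_or_nonempty with rfl | ⟨x₀, hx₀⟩
  · exact ⟨0, 0, 1, one_ne_zero, by simp⟩
  rcases Q.eq_empty_or_nonempty with rfl | ⟨y₀, hy₀⟩
  · exact ⟨0, 0, 1, one_ne_zero, by simp⟩
  have hiff : ∀ x ∈ R, ∀ y ∈ Q, (curv a x₀ x y₀ y = 0 ↔ curv a' x₀ x y₀ y = 0) := by
    intro x hx y hy
    rw [h _ hx₀ _ hx _ hy₀ _ hy, h' _ hx₀ _ hx _ hy₀ _ hy]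
  suffices ∃ μ : K, μ ≠ 0 ∧ ∀ x ∈ R, ∀ y ∈ Q, curv a' x₀ x y₀ y = μ * curv a x₀ x y₀ y by
    obtain ⟨μ, hμ, H⟩ := this
    refine ⟨fun x => a' x y₀ - a' x₀ y₀ + μ * (a x₀ y₀ - a x y₀), fun y => a' x₀ y - μ * a x₀ y,
      μ, hμ, fun x hx y hy => ?_⟩
    have := H x hx y hy
    unfold curv at this
    linear_combination this
  by_cases hz : ∀ x ∈ R, ∀ y ∈ Q, curv a x₀ x y₀ y = 0
  · refine ⟨1, one_ne_zero, fun x hx y hy => ?_⟩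
    rw [hz x hx y hy, (hiff x hx y hy).1 (hz x hx y hy), mul_zero]
  · push Not at hz
    obtain ⟨x₁, hx₁, y₁, hy₁, hne⟩ := hz
    have hne' : curv a' x₀ x₁ y₀ y₁ ≠ 0 := fun e => hne ((hiff _ hx₁ _ hy₁).2 e)
    refine ⟨curv a' x₀ x₁ y₀ y₁ / curv a x₀ x₁ y₀ y₁, div_ne_zero hne' hne, fun x hx y hy => ?_⟩
    by_cases h0 : curv a x₀ x y₀ y = 0
    · rw [h0, (hiff x hx y hy).1 h0, mul_zero]
    · have h0' : curv a' x₀ x y₀ y ≠ 0 := fun e => h0 ((hiff _ hx _ hy).2 e)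
      rw [curv_eq_of_sign hx₀ hy₀ hT h hx hx₁ hy hy₁ h0 hne,
        curv_eq_of_sign hx₀ hy₀ hT h' hx hx₁ hy hy₁ h0' hne', div_mul_cancel₀ _ hne]

end Curvature

section SpanExchange

variable {α : Type*}

/-- The nonzero elements of `GF(4)` are parametrised by exponents modulo three. -/
lemma exists_gf4_log : ∃ (E : ZMod 3 → Relax.GF4) (lg : Relax.GF4 → ZMod 3), (∀ t, E t ≠ 0) ∧
    (∀ s t, E (s + t) = E s * E t) ∧ (∀ t, lg (E t) = t) ∧ ∀ a, a ≠ 0 → E (lg a) = a := by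
  have : Finite Relax.GF4 := Nat.finite_of_card_ne_zero (by
    rw [GaloisField.card 2 2 two_ne_zero]; norm_num)
  have h1 : Nat.card (Relax.GF4)ˣ = 3 := by
    rw [Nat.card_units, GaloisField.card 2 2 two_ne_zero]; norm_num
  have h2 : Nat.card (Multiplicative (ZMod 3)) = 3 := by simp
  have : Fact (Nat.Prime 3) := ⟨by norm_num⟩
  let e : Multiplicative (ZMod 3) ≃* (Relax.GF4)ˣ := mulEquivOfPrimeCardEq h2 h1
  refine ⟨fun t => e (Multiplicative.ofAdd t),
    fun a => if h : a = 0 then 0 else (e.symm (Units.mk0 a h)).toAdd, fun t => Units.ne_zero _,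
    fun s t => ?_, fun t => ?_, fun a ha => ?_⟩
  · simp [ofAdd_add]
  · simp
  · simp [ha]

variable {F₁ F₂ V₁ V₂ : Type*} [Field F₁] [Field F₂] [AddCommGroup V₁] [Module F₁ V₁]
  [AddCommGroup V₂] [Module F₂ V₂] [FiniteDimensional F₁ V₁] [FiniteDimensional F₂ V₂]

lemma insert_erase_eq {Q : Finset α} {x y : α} :
    insert x (Q.erase y) = Q \ {y} ∪ {x} := by
  rw [Finset.sdiff_singleton_eq_erase, Finset.union_comm]; rfl

lemma insert_erase_ne {R Q : Finset α} (hd : Disjoint R Q) (hQ : 2 ≤ Q.card) {x : α}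
    (hx : x ∈ R) (y : α) : insert x (Q.erase y) ≠ Q ∧ insert x (Q.erase y) ≠ R := by
  constructor
  · intro h
    rw [← h] at hd
    exact Finset.disjoint_left.1 hd hx (Finset.mem_insert_self _ _)
  · intro h
    obtain ⟨z, hz, hne⟩ := Finset.exists_mem_ne (s := Q) (by omega) y
    refine Finset.disjoint_right.1 hd hz ?_
    rw [← h]
    exact Finset.mem_insert_of_mem (Finset.mem_erase.2 ⟨hne, hz⟩)

lemma card_insert_erase {R Q : Finset α} (hd : Disjoint R Q) {x y : α}
    (hx : x ∈ R) (hy : y ∈ Q) : (insert x (Q.erase y)).card = Q.card := by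
  rw [Finset.card_insert_of_notMem, Finset.card_erase_add_one hy]
  exact fun h => Finset.disjoint_left.1 hd hx (Finset.mem_of_mem_erase h)

/-- If two configurations agree except on `R` and `Q`, and disagree on `Q`, then every exchange of
`Q` with `R` is independent. -/
lemma linearIndepOn_exchange_of_disagree {u₁ : α → V₁} {u₂ : α → V₂} {R Q : Finset α}
    (hd : Disjoint R Q) (hk : 2 ≤ Q.card) (hRQ : R.card = Q.card)
    (h₁ : Q.card = Module.finrank F₁ V₁) (h₂ : Q.card = Module.finrank F₂ V₂)
    (hag : ∀ S ⊆ R ∪ Q, S.card = Q.card → S ≠ Q → S ≠ R →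
      (LinearIndepOn F₁ u₁ (S : Set α) ↔ LinearIndepOn F₂ u₂ (S : Set α)))
    (hex : ∀ x ∈ R, ∀ y ∈ Q, LinearIndepOn F₁ u₁ ((insert y (R.erase x) : Finset α) : Set α))
    (hQ₁ : LinearIndepOn F₁ u₁ (Q : Set α)) (hQ₂ : ¬ LinearIndepOn F₂ u₂ (Q : Set α)) :
    ∀ x ∈ R, ∀ y ∈ Q, LinearIndepOn F₁ u₁ ((insert x (Q.erase y) : Finset α) : Set α) := by
  have hag' : ∀ x ∈ R, ∀ y ∈ Q,
      (LinearIndepOn F₁ u₁ ((insert x (Q.erase y) : Finset α) : Set α) ↔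
        LinearIndepOn F₂ u₂ ((insert x (Q.erase y) : Finset α) : Set α)) := by
    intro x hx y hy
    refine hag _ ?_ (card_insert_erase hd hx hy) (insert_erase_ne hd hk hx y).1
      (insert_erase_ne hd hk hx y).2
    intro z hz
    rcases Finset.mem_insert.1 hz with rfl | hz
    · exact Finset.mem_union_left _ hx
    · exact Finset.mem_union_right _ (Finset.mem_of_mem_erase hz)
  have hnm : ∀ x ∈ R, ∀ y, x ∉ ((Q.erase y : Finset α) : Set α) := fun x hx y h =>
    Finset.disjoint_left.1 hd hx (Finset.mem_of_mem_erase h)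
  intro x hx y hy
  by_contra hxy
  -- an element of `R` which can replace `y` in `Q`
  obtain ⟨x', hx', hx'y⟩ : ∃ x' ∈ R,
      LinearIndepOn F₁ u₁ ((insert x' (Q.erase y) : Finset α) : Set α) := by
    obtain ⟨y₁, hy₁, hne⟩ := Finset.exists_mem_ne (s := Q) (by omega) y
    have hQy : y ∉ ((Q.erase y : Finset α) : Set α) := by simp
    have hins : insert y (Q.erase y : Finset α) = Q := Finset.insert_erase hy
    have h1 := hQ₁
    rw [← hins, Finset.coe_insert, linearIndepOn_insert hQy] at h1
    obtain ⟨l, hl, hker⟩ := Submodule.exists_le_ker_of_notMem h1.2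
    by_contra hcon
    push Not at hcon
    have hl0 : ∀ z ∈ R, l (u₁ z) = 0 := by
      intro z hz
      have := hcon z hz
      rw [Finset.coe_insert, linearIndepOn_insert (hnm z hz y)] at this
      by_contra h0
      exact this ⟨h1.1, fun h => h0 (hker h)⟩
    have hcard : (insert y₁ (R.erase x)).card = Module.finrank F₁ V₁ := by
      rw [card_insert_erase hd.symm hy₁ hx, hRQ, h₁]
    obtain ⟨c, hc⟩ := exists_coordinates (hex x hx y₁ hy₁) hcard (u₁ y)
    apply hl
    rw [hc, map_sum]
    refine Finset.sum_eq_zero fun z hz => ?_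
    rw [map_smul]
    rcases Finset.mem_insert.1 hz with rfl | hz
    · rw [show l (u₁ z) = 0 from hker (Submodule.subset_span
        ⟨z, by simpa [hne] using hy₁, rfl⟩), smul_zero]
    · rw [hl0 z (Finset.mem_of_mem_erase hz), smul_zero]
  -- an element of `Q` which `x` can replace
  obtain ⟨y', hy', hne, hxy'⟩ : ∃ y' ∈ Q, y' ≠ y ∧
      LinearIndepOn F₁ u₁ ((insert x (Q.erase y') : Finset α) : Set α) := by
    obtain ⟨T, hT⟩ := exists_coordinate_matrix hQ₁ h₁
    have hiff : ∀ z ∈ Q, (LinearIndepOn F₁ u₁ ((insert x (Q.erase z) : Finset α) : Set α) ↔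
        T z x ≠ 0) := by
      intro z hz
      rw [insert_erase_eq, linearIndepOn_exchange_iff (T := T) hQ₁ (by simpa using hz)
        (by simpa using Finset.disjoint_left.1 hd hx) (fun y _ => hT y)]
      exact columnsIndep_singleton
    by_contra hcon
    push Not at hcon
    have hT0 : ∀ z ∈ Q, T z x = 0 := by
      intro z hz
      by_contra h0
      by_cases hzy : z = y
      · subst hzy
        exact hxy ((hiff z hz).2 h0)
      · exact hcon z hz hzy ((hiff z hz).2 h0)
    obtain ⟨x₁, hx₁, hne⟩ := Finset.exists_mem_ne (s := R) (by omega) x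
    have := (hex x₁ hx₁ y hy).ne_zero (i := x) (by simp [hne.symm, hx])
    apply this
    rw [hT x]
    exact Finset.sum_eq_zero fun z hz => by rw [hT0 z hz, zero_smul]
  -- in the second configuration everything lies in the span of `Q - y`
  have e1 := (hag' x' hx' y hy).1 hx'y
  have e2 := (hag' x hx y' hy').1 hxy'
  rw [hag' x hx y hy] at hxy
  rw [Finset.coe_insert, linearIndepOn_insert (hnm x' hx' y)] at e1
  rw [Finset.coe_insert, linearIndepOn_insert (hnm x hx y)] at hxy
  have hxs : u₂ x ∈ Submodule.span F₂ (u₂ '' ((Q.erase y : Finset α) : Set α)) := by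
    by_contra h; exact hxy ⟨e1.1, h⟩
  have hys : u₂ y ∈ Submodule.span F₂ (u₂ '' ((Q.erase y : Finset α) : Set α)) := by
    by_contra h
    refine hQ₂ ?_
    rw [← Finset.insert_erase hy, Finset.coe_insert, linearIndepOn_insert (by simp)]
    exact ⟨e1.1, h⟩
  obtain ⟨c, hc⟩ := exists_coordinates e2 (by rw [card_insert_erase hd hx hy', h₂]) (u₂ x')
  apply e1.2
  rw [hc]
  refine Submodule.sum_mem _ fun z hz => Submodule.smul_mem _ _ ?_
  rcases Finset.mem_insert.1 hz with rfl | hz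
  · exact hxs
  · by_cases hzy : z = y
    · subst hzy; exact hys
    · exact Submodule.subset_span ⟨z, by simpa [hzy] using Finset.mem_of_mem_erase hz, rfl⟩

end SpanExchange

section RelaxedConfigurations

variable {α : Type*} {V V' W : Type*} [AddCommGroup V] [Module Relax.GF4 V]
  [AddCommGroup V'] [Module Relax.GF4 V'] [AddCommGroup W] [Module (ZMod 3) W]
  [FiniteDimensional Relax.GF4 V] [FiniteDimensional Relax.GF4 V']
  [FiniteDimensional (ZMod 3) W]

lemma sdiff_union_card {R Q P P' : Finset α} (hd : Disjoint R Q) (hP : P ⊆ Q) (hP' : P' ⊆ R)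
    (hc : P.card = P'.card) : (Q \ P ∪ P').card = Q.card := by
  rw [Finset.card_union_of_disjoint, Finset.card_sdiff_of_subset hP]
  · have := Finset.card_le_card hP
    omega
  · exact Finset.disjoint_of_subset_left Finset.sdiff_subset
      (Finset.disjoint_of_subset_right hP' hd.symm)

lemma sdiff_union_subset {R Q P P' : Finset α} (hP' : P' ⊆ R) : Q \ P ∪ P' ⊆ R ∪ Q :=
  Finset.union_subset (Finset.sdiff_subset.trans Finset.subset_union_right)
    (hP'.trans Finset.subset_union_left)

lemma sdiff_union_ne {R Q P P' : Finset α} (hd : Disjoint R Q) (hP' : P' ⊆ R)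
    (hc : P.card < Q.card) (hne : P'.Nonempty) : Q \ P ∪ P' ≠ Q ∧ Q \ P ∪ P' ≠ R := by
  constructor
  · intro h
    obtain ⟨x, hx⟩ := hne
    exact Finset.disjoint_left.1 hd (hP' hx) (h ▸ Finset.mem_union_right _ hx)
  · intro h
    obtain ⟨z, hz, hzP⟩ := Finset.exists_mem_notMem_of_card_lt_card hc
    exact Finset.disjoint_right.1 hd hz
      (h ▸ Finset.mem_union_left _ (Finset.mem_sdiff.2 ⟨hz, hzP⟩))

/-- Independence of a `k`-set `Q` transfers from quaternary to ternary coordinates, if all other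
`k`-sets except `R` behave in the same way, and `R` is relaxed. -/
lemma linearIndepOn_iff_of_relaxed {v : α → V} {v' : α → V'} {w : α → W} {R Q : Finset α}
    (hd : Disjoint R Q) (hk : 3 ≤ Q.card) (hRQ : R.card = Q.card)
    (h₁ : Q.card = Module.finrank Relax.GF4 V) (h₂ : Q.card = Module.finrank Relax.GF4 V')
    (h₃ : Q.card = Module.finrank (ZMod 3) W)
    (hvv : ∀ S ⊆ R ∪ Q, S.card = Q.card → S ≠ R →
      (LinearIndepOn Relax.GF4 v (S : Set α) ↔ LinearIndepOn Relax.GF4 v' (S : Set α)))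
    (hvw : ∀ S ⊆ R ∪ Q, S.card = Q.card → S ≠ Q → S ≠ R →
      (LinearIndepOn Relax.GF4 v (S : Set α) ↔ LinearIndepOn (ZMod 3) w (S : Set α)))
    (hR : ¬ LinearIndepOn Relax.GF4 v (R : Set α)) (hR' : LinearIndepOn Relax.GF4 v' (R : Set α))
    (hex : ∀ x ∈ R, ∀ y ∈ Q,
      LinearIndepOn Relax.GF4 v ((insert y (R.erase x) : Finset α) : Set α)) :
    LinearIndepOn Relax.GF4 v (Q : Set α) ↔ LinearIndepOn (ZMod 3) w (Q : Set α) := by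
  have hQR : Q ≠ R := by
    rintro rfl
    rw [disjoint_self] at hd
    simp [hd] at hk
  have hQQ : Q ⊆ R ∪ Q := Finset.subset_union_right
  have hcard : ∀ x ∈ R, ∀ y ∈ Q, (insert x (Q.erase y)).card = Q.card := fun x hx y hy =>
    card_insert_erase hd hx hy
  have hsub : ∀ x ∈ R, ∀ y ∈ Q, insert x (Q.erase y) ⊆ R ∪ Q := by
    intro x hx y hy
    rw [insert_erase_eq]
    exact sdiff_union_subset (by simpa using hx)
  have hne := fun x (hx : x ∈ R) y => insert_erase_ne hd (by omega) hx (y := y)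
  have hpair : ∀ x ∈ R, ∀ x' ∈ R, ∀ y ∈ Q, ∀ y' ∈ Q, x ≠ x' → y ≠ y' →
      (LinearIndepOn Relax.GF4 v ((Q \ {y, y'} ∪ {x, x'} : Finset α) : Set α) ↔
        LinearIndepOn Relax.GF4 v' ((Q \ {y, y'} ∪ {x, x'} : Finset α) : Set α)) ∧
      (LinearIndepOn Relax.GF4 v ((Q \ {y, y'} ∪ {x, x'} : Finset α) : Set α) ↔
        LinearIndepOn (ZMod 3) w ((Q \ {y, y'} ∪ {x, x'} : Finset α) : Set α)) := by
    intro x hx x' hx' y hy y' hy' hxx hyy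
    have a1 : ({x, x'} : Finset α) ⊆ R := by
      simp [Finset.insert_subset_iff, hx, hx']
    have a2 : ({y, y'} : Finset α) ⊆ Q := by
      simp [Finset.insert_subset_iff, hy, hy']
    have a3 := Finset.card_pair hxx
    have a4 := Finset.card_pair hyy
    have a5 := sdiff_union_ne (P := {y, y'}) hd a1 (by omega) ⟨x, by simp⟩
    have a6 := sdiff_union_card hd a2 a1 (by omega)
    exact ⟨hvv _ (sdiff_union_subset a1) a6 a5.2, hvw _ (sdiff_union_subset a1) a6 a5.1 a5.2⟩
  by_contra hcon
  by_cases hQ : LinearIndepOn Relax.GF4 v (Q : Set α)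
  · -- compare the coordinates with respect to the basis `Q`
    have hQw : ¬ LinearIndepOn (ZMod 3) w (Q : Set α) := fun h => hcon ⟨fun _ => h, fun _ => hQ⟩
    have hQ' := (hvv Q hQQ rfl hQR).1 hQ
    have hx := linearIndepOn_exchange_of_disagree hd (by omega) hRQ h₁ h₃ hvw hex hQ hQw
    obtain ⟨T, hT⟩ := exists_coordinate_matrix hQ h₁
    obtain ⟨T', hT'⟩ := exists_coordinate_matrix hQ' h₂
    have cr : ∀ P ⊆ Q, ∀ P' ⊆ R, (LinearIndepOn Relax.GF4 v ((Q \ P ∪ P' : Finset α) : Set α) ↔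
        ColumnsIndep T P P') := fun P hP P' hP' =>
      linearIndepOn_exchange_iff hQ hP (hd.symm.mono_right hP') (fun y _ => hT y)
    have cr' : ∀ P ⊆ Q, ∀ P' ⊆ R, (LinearIndepOn Relax.GF4 v' ((Q \ P ∪ P' : Finset α) : Set α) ↔
        ColumnsIndep T' P P') := fun P hP P' hP' =>
      linearIndepOn_exchange_iff hQ' hP (hd.symm.mono_right hP') (fun y _ => hT' y)
    have nz : ∀ y ∈ Q, ∀ x ∈ R, T y x ≠ 0 := by
      intro y hy x hx'
      have := hx x hx' y hy
      rw [insert_erase_eq, cr _ (by simpa using hy) _ (by simpa using hx')] at this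
      exact columnsIndep_singleton.1 this
    have nz' : ∀ y ∈ Q, ∀ x ∈ R, T' y x ≠ 0 := by
      intro y hy x hx'
      have := (hvv _ (hsub x hx' y hy) (hcard x hx' y hy) (hne x hx' y).2).1 (hx x hx' y hy)
      rw [insert_erase_eq, cr' _ (by simpa using hy) _ (by simpa using hx')] at this
      exact columnsIndep_singleton.1 this
    obtain ⟨E, lg, hE0, hEadd, hlgE, hElg⟩ := exists_gf4_log
    have cross : ∀ U : α → α → Relax.GF4, (∀ y ∈ Q, ∀ x ∈ R, U y x ≠ 0) →
        ∀ y ∈ Q, ∀ y' ∈ Q, ∀ x ∈ R, ∀ x' ∈ R,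
        (U y x * U y' x' = U y x' * U y' x ↔ curv (fun y x => lg (U y x)) y y' x x' = 0) := by
      intro U hU y hy y' hy' x hx x' hx'
      rw [← hElg _ (hU y hy x hx), ← hElg _ (hU y' hy' x' hx'), ← hElg _ (hU y hy x' hx'),
        ← hElg _ (hU y' hy' x hx), ← hEadd, ← hEadd]
      simp only [curv]
      constructor
      · intro h
        have := congrArg lg h
        rw [hlgE, hlgE] at this
        linear_combination this
      · intro h
        congr 1
        linear_combination h
    have hc : ∀ y ∈ Q, ∀ y' ∈ Q, ∀ x ∈ R, ∀ x' ∈ R, y ≠ y' → x ≠ x' →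
        (curv (fun y x => lg (T y x)) y y' x x' = 0 ↔
          curv (fun y x => lg (T' y x)) y y' x x' = 0) := by
      intro y hy y' hy' x hx x' hx' hyy hxx
      rw [← cross T nz y hy y' hy' x hx x' hx', ← cross T' nz' y hy y' hy' x hx x' hx']
      have a1 : ({x, x'} : Finset α) ⊆ R := by
        simp [Finset.insert_subset_iff, hx, hx']
      have a2 : ({y, y'} : Finset α) ⊆ Q := by
        simp [Finset.insert_subset_iff, hy, hy']
      have := (hpair x hx x' hx' y hy y' hy' hxx hyy).1
      rw [cr _ a2 _ a1, cr' _ a2 _ a1, columnsIndep_pair hxx (nz y hy x hx),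
        columnsIndep_pair hxx (nz' y hy x hx)] at this
      exact not_iff_not.1 this
    have fin : ColumnsIndep T' Q R := by
      have := cr' Q subset_rfl R subset_rfl
      rw [Finset.sdiff_self, Finset.empty_union] at this
      exact this.1 hR'
    have fin' : ¬ ColumnsIndep T Q R := by
      have := cr Q subset_rfl R subset_rfl
      rw [Finset.sdiff_self, Finset.empty_union] at this
      exact fun h => hR (this.2 h)
    obtain ⟨p, q, h | h⟩ := exists_shift_of_curv_iff hc
    · refine fin' (fin.of_scaling (r := fun y => (E (p y))⁻¹) (s := fun x => (E (q x))⁻¹)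
        (fun _ _ => inv_ne_zero (hE0 _)) (fun _ _ => inv_ne_zero (hE0 _)) fun y hy x hx => ?_)
      have := congrArg E (h y hy x hx)
      rw [hEadd, hEadd, hElg _ (nz y hy x hx), hElg _ (nz' y hy x hx)] at this
      rw [this]
      have i1 := hE0 (p y)
      have i2 := hE0 (q x)
      field_simp
    · refine fin' ?_
      have fr : ColumnsIndep (fun y x => frobeniusEquiv Relax.GF4 2 (T' y x)) Q R := fin.map _
      refine fr.of_scaling (r := fun y => E (p y)) (s := fun x => E (q x))
        (fun _ _ => hE0 _) (fun _ _ => hE0 _) fun y hy x hx => ?_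
      have h3 : lg (T y x) = p y + q x + (lg (T' y x) + lg (T' y x)) := by
        have three : (3 : ZMod 3) = 0 := by decide
        linear_combination h y hy x hx - lg (T' y x) * three
      rw [← hElg _ (nz y hy x hx), h3, hEadd, hEadd, hEadd, hElg _ (nz' y hy x hx),
        frobeniusEquiv_apply, frobenius_def, sq]
  · have hQw : LinearIndepOn (ZMod 3) w (Q : Set α) := by
      by_contra h
      exact hcon ⟨fun h' => absurd h' hQ, fun h' => absurd h' h⟩
    have hQ' : ¬ LinearIndepOn Relax.GF4 v' (Q : Set α) := fun h => hQ ((hvv Q hQQ rfl hQR).2 h)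
    have hxw := linearIndepOn_exchange_of_disagree hd (by omega) hRQ h₃ h₁
      (fun S h1 h2 h3 h4 => (hvw S h1 h2 h3 h4).symm)
      (fun x hx y hy => (hvw _ (by
        rw [insert_erase_eq, Finset.union_comm R Q]; exact sdiff_union_subset (by simpa using hy))
        ((card_insert_erase hd.symm hy hx).trans hRQ)
        (insert_erase_ne hd.symm (by omega) hy x).2
        (insert_erase_ne hd.symm (by omega) hy x).1).1 (hex x hx y hy)) hQw hQ
    have hxv : ∀ x ∈ R, ∀ y ∈ Q,
        LinearIndepOn Relax.GF4 v ((insert x (Q.erase y) : Finset α) : Set α) := fun x hx y hy =>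
      (hvw _ (hsub x hx y hy) (hcard x hx y hy) (hne x hx y).1 (hne x hx y).2).2 (hxw x hx y hy)
    have hxv' : ∀ x ∈ R, ∀ y ∈ Q,
        LinearIndepOn Relax.GF4 v' ((insert x (Q.erase y) : Finset α) : Set α) := fun x hx y hy =>
      (hvv _ (hsub x hx y hy) (hcard x hx y hy) (hne x hx y).2).1 (hxv x hx y hy)
    have hRne : R.Nonempty := Finset.card_pos.1 (by omega)
    have hQne : Q.Nonempty := Finset.card_pos.1 (by omega)
    obtain ⟨a, ha⟩ := exists_affine_coordinates h₁ hQ hRne hd.symm (fun y hy x hx => hxv x hx y hy)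
    obtain ⟨a', ha'⟩ := exists_affine_coordinates h₂ hQ' hRne hd.symm
      (fun y hy x hx => hxv' x hx y hy)
    obtain ⟨T, hT⟩ := exists_coordinate_matrix hQw h₃
    have cr : ∀ P ⊆ Q, ∀ P' ⊆ R, (LinearIndepOn (ZMod 3) w ((Q \ P ∪ P' : Finset α) : Set α) ↔
        ColumnsIndep T P P') := fun P hP P' hP' =>
      linearIndepOn_exchange_iff hQw hP (hd.symm.mono_right hP') (fun y _ => hT y)
    have nz : ∀ y ∈ Q, ∀ x ∈ R, T y x ≠ 0 := by
      intro y hy x hx'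
      have := hxw x hx' y hy
      rw [insert_erase_eq, cr _ (by simpa using hy) _ (by simpa using hx')] at this
      exact columnsIndep_singleton.1 this
    have hc : ∀ y ∈ Q, ∀ y' ∈ Q, ∀ x ∈ R, ∀ x' ∈ R, y ≠ y' → x ≠ x' →
        (curv a y y' x x' = 0 ↔ T y x * T y' x' = T y x' * T y' x) ∧
        (curv a' y y' x x' = 0 ↔ T y x * T y' x' = T y x' * T y' x) := by
      intro y hy y' hy' x hx x' hx' hyy hxx
      have a1 : ({x, x'} : Finset α) ⊆ R := by
        simp [Finset.insert_subset_iff, hx, hx']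
      have a2 : ({y, y'} : Finset α) ⊆ Q := by
        simp [Finset.insert_subset_iff, hy, hy']
      obtain ⟨e1, e2⟩ := hpair x hx x' hx' y hy y' hy' hxx hyy
      rw [e1] at e2
      rw [ha _ a2 ⟨y, by simp⟩ _ a1, ha' _ a2 ⟨y, by simp⟩ _ a1, columnsAffineIndep_pair hxx,
        columnsAffineIndep_pair hxx] at e1
      rw [cr _ a2 _ a1, ha' _ a2 ⟨y, by simp⟩ _ a1, columnsAffineIndep_pair hxx,
        columnsIndep_pair hxx (nz y hy x hx)] at e2
      have e3 := not_iff_not.1 e2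
      exact ⟨(not_iff_not.1 e1).trans e3, e3⟩
    obtain ⟨p, q, μ, hμ, h⟩ := exists_scaled_shift_of_sign nz
      (fun y hy y' hy' x hx x' hx' hyy hxx => (hc y hy y' hy' x hx x' hx' hyy hxx).2)
      (fun y hy y' hy' x hx x' hx' hyy hxx => (hc y hy y' hy' x hx x' hx' hyy hxx).1)
    have fin := (ha' Q subset_rfl hQne R subset_rfl).1 (by
      rw [Finset.sdiff_self, Finset.empty_union]; exact hR')
    refine hR ?_
    have := (ha Q subset_rfl hQne R subset_rfl).2 (fin.of_scaling hμ h)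
    rwa [Finset.sdiff_self, Finset.empty_union] at this

end RelaxedConfigurations

section Ternary

variable {α : Type*}

/-- The dimension of the quotient by the span of an independent set. -/
lemma finrank_quotient_span {K V : Type*} [Field K] [AddCommGroup V] [Module K V]
    [FiniteDimensional K V] {v : α → V} {S : Finset α} (hS : LinearIndepOn K v (S : Set α)) :
    Module.finrank K (V ⧸ Submodule.span K (v '' (S : Set α))) + S.card = Module.finrank K V := by
  have h1 := Submodule.finrank_quotient_add_finrank (Submodule.span K (v '' (S : Set α)))
  have h2 : Module.finrank K (Submodule.span K (v '' (S : Set α))) = S.card := by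
    rw [Set.image_eq_range]
    exact (finrank_span_eq_card hS).trans (by simp)
  omega

lemma sdiff_union_eq {X P Q S : Finset α} (hP : P ⊆ X) (hS : S ⊆ P ∪ Q) :
    X \ P ∪ S = X \ (P \ S) ∪ (S ∩ Q) := by
  ext z
  have h1 := @hS z
  have h2 := @hP z
  simp only [Finset.mem_union, Finset.mem_sdiff, Finset.mem_inter] at h1 ⊢
  tauto

lemma card_sdiff_eq_card_inter {P Q S : Finset α} (hd : Disjoint P Q) (hS : S ⊆ P ∪ Q)
    (h : S.card = P.card) : (P \ S).card = (S ∩ Q).card := by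
  have h1 := Finset.card_sdiff_add_card_inter P S
  have h2 : S = (P ∩ S) ∪ (S ∩ Q) := by
    ext z
    have h1 := @hS z
    simp only [Finset.mem_union, Finset.mem_inter] at h1 ⊢
    tauto
  have h3 : S.card = (P ∩ S).card + (S ∩ Q).card := by
    conv_lhs => rw [h2]
    exact Finset.card_union_of_disjoint (hd.mono Finset.inter_subset_left
      Finset.inter_subset_right)
  omega

lemma exists_linearIndepOn_iff_fin {K V : Type*} [Field K] [AddCommGroup V] [Module K V]
    [FiniteDimensional K V] (v : α → V) :
    ∃ w : α → (Fin (Module.finrank K V) → K), ∀ S : Set α,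
      LinearIndepOn K w S ↔ LinearIndepOn K v S := by
  let b := (Module.finBasis K V).equivFun
  exact ⟨fun z => b (v z), fun S =>
    LinearMap.linearIndependent_iff (b : V →ₗ[K] (Fin (Module.finrank K V) → K)) (by simp)⟩

/-- Ternary vectors with the coordinates `b` relative to a circuit `X` containing `e`. -/
noncomputable def ternaryVector (X : Finset α) (e : α) (b : α → α → ZMod 3) (z : α) :
    (↥(X.erase e) → ZMod 3) × ZMod 3 :=
  if z = e then (fun _ => -1, 0)
  else if z ∈ X then (fun x => if (x : α) = z then 1 else 0, 0)
  else (fun x => b x z - b e z, 1)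

lemma linearIndepOn_ternaryVector_iff {X Y : Finset α} {e : α} {b : α → α → ZMod 3}
    (he : e ∈ X) (hd : Disjoint X Y) {P Q : Finset α} (hP : P ⊆ X) (hPne : P.Nonempty)
    (hQ : Q ⊆ Y) :
    (∀ x ∈ X, LinearIndepOn (ZMod 3) (ternaryVector X e b) ((X.erase x : Finset α) : Set α)) ∧
    ¬ LinearIndepOn (ZMod 3) (ternaryVector X e b) (X : Set α) ∧
    (LinearIndepOn (ZMod 3) (ternaryVector X e b) ((X \ P ∪ Q : Finset α) : Set α) ↔
      ColumnsAffineIndep b P Q) := by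
  set w := ternaryVector X e b with hw
  have w2 : ∀ x ∈ X, (w x).2 = 0 := by
    intro x hx
    simp only [hw, ternaryVector]
    split_ifs <;> rfl
  have w1 : ∀ f : α → ZMod 3, ∀ z (hz : z ∈ X.erase e),
      (∑ x ∈ X, f x • w x).1 ⟨z, hz⟩ = f z - f e := by
    intro f z hz
    have hz' := Finset.mem_erase.1 hz
    rw [← Finset.add_sum_erase X _ he, Prod.fst_add, Prod.fst_sum, Pi.add_apply,
      Finset.sum_apply, Finset.sum_eq_single_of_mem z hz]
    · simp [hw, ternaryVector, hz'.1, hz'.2]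
      ring
    · intro x hx hxz
      have hx' := Finset.mem_erase.1 hx
      simp [hw, ternaryVector, hx'.1, hx'.2, hxz.symm]
  have wsum2 : ∀ f : α → ZMod 3, (∑ x ∈ X, f x • w x).2 = 0 := by
    intro f
    rw [Prod.snd_sum]
    exact Finset.sum_eq_zero fun x hx => by rw [Prod.smul_snd, w2 x hx, smul_zero]
  have hsum : ∑ x ∈ X, w x = 0 := by
    have h : ∑ x ∈ X, w x = ∑ x ∈ X, (1 : ZMod 3) • w x := by simp
    rw [h]
    refine Prod.ext (funext fun ⟨z, hz⟩ => ?_) (wsum2 _)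
    rw [w1 (fun _ => 1) z hz]; simp
  have hXe : ∀ x ∈ X, LinearIndepOn (ZMod 3) w ((X.erase x : Finset α) : Set α) := by
    intro x hx
    rw [linearIndepOn_finset_iff]
    intro f hf
    have h1 : ∑ z ∈ X, (if z = x then 0 else f z) • w z = 0 := by
      rw [← Finset.add_sum_erase X _ hx, if_pos rfl, zero_smul, zero_add, ← hf]
      exact Finset.sum_congr rfl fun z hz => by rw [if_neg (Finset.ne_of_mem_erase hz)]
    have h2 : ∀ z ∈ X, (if z = x then 0 else f z) = (if e = x then 0 else f e) := by
      intro z hz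
      by_cases hze : z = e
      · rw [hze]
      · have := w1 (fun z => if z = x then 0 else f z) z (Finset.mem_erase.2 ⟨hze, hz⟩)
        rw [h1] at this
        exact (sub_eq_zero.1 this.symm)
    intro z hz
    have h3 := h2 z (Finset.mem_of_mem_erase hz)
    rw [if_neg (Finset.ne_of_mem_erase hz)] at h3
    rw [h3, ← h2 x hx, if_pos rfl]
  refine ⟨hXe, ?_, ?_⟩
  · rw [linearIndepOn_finset_iff]
    intro h
    exact one_ne_zero (h (fun _ => (1 : ZMod 3)) (by simpa using hsum) e he)
  · refine linearIndepOn_circuit_exchange_iff (v₀ := (0, 1)) (l := LinearMap.snd _ _ _) hsum hXe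
      w2 rfl hP hPne (hd.mono_right hQ) fun y hy => ?_
    have hyX : y ∉ X := Finset.disjoint_right.1 hd (hQ hy)
    have hye : y ≠ e := by rintro rfl; exact hyX he
    refine Prod.ext (funext fun ⟨z, hz⟩ => ?_) ?_
    · rw [Prod.fst_add, Pi.add_apply, w1 (fun x => b x y) z hz]
      simp [hw, ternaryVector, hyX, hye]
    · rw [Prod.snd_add, wsum2]
      simp [hw, ternaryVector, hyX, hye]

variable {V V' : Type*} [AddCommGroup V] [Module Relax.GF4 V]
  [AddCommGroup V'] [Module Relax.GF4 V']
  [FiniteDimensional Relax.GF4 V] [FiniteDimensional Relax.GF4 V']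

set_option maxHeartbeats 1000000 in
/-- If two quaternary configurations differ only in a relaxed set `X`, then the first one has the
independent sets of a ternary configuration. -/
theorem exists_ternary_of_relaxed {v : α → V} {v' : α → V'} {X Y : Finset α}
    (hd : Disjoint X Y) (hXne : X.Nonempty) (hYne : Y.Nonempty)
    (h₁ : X.card = Module.finrank Relax.GF4 V) (h₂ : X.card = Module.finrank Relax.GF4 V')
    (hvv : ∀ S ⊆ X ∪ Y, S.card = X.card → S ≠ X →
      (LinearIndepOn Relax.GF4 v (S : Set α) ↔ LinearIndepOn Relax.GF4 v' (S : Set α)))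
    (hX : ¬ LinearIndepOn Relax.GF4 v (X : Set α)) (hX' : LinearIndepOn Relax.GF4 v' (X : Set α))
    (hex : ∀ x ∈ X, ∀ y ∈ Y,
      LinearIndepOn Relax.GF4 v ((insert y (X.erase x) : Finset α) : Set α)) :
    ∃ (n : ℕ) (w : α → (Fin n → ZMod 3)), n = X.card ∧ ∀ S ⊆ X ∪ Y, S.card = X.card →
      (LinearIndepOn Relax.GF4 v (S : Set α) ↔ LinearIndepOn (ZMod 3) w (S : Set α)) := by
  obtain ⟨e, he⟩ := hXne
  obtain ⟨y₀, hy₀⟩ := hYne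
  obtain ⟨T, hT⟩ := exists_coordinate_matrix hX' h₂
  obtain ⟨E, lg, hE0, hEadd, hlgE, hElg⟩ := exists_gf4_log
  have cr : ∀ P ⊆ X, ∀ Q ⊆ Y, (LinearIndepOn Relax.GF4 v' ((X \ P ∪ Q : Finset α) : Set α) ↔
      ColumnsIndep T P Q) := fun P hP Q hQ =>
    linearIndepOn_exchange_iff hX' hP (hd.mono_right hQ) (fun y _ => hT y)
  have hsubP : ∀ P ⊆ X, ∀ Q ⊆ Y, X \ P ∪ Q ⊆ X ∪ Y := fun P _ Q hQ =>
    Finset.union_subset_union Finset.sdiff_subset hQ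
  have hcardP : ∀ P ⊆ X, ∀ Q ⊆ Y, P.card = Q.card → (X \ P ∪ Q).card = X.card :=
    fun P hP Q hQ h => sdiff_union_card hd.symm hP hQ h
  have hneP : ∀ P : Finset α, ∀ Q ⊆ Y, Q.Nonempty → X \ P ∪ Q ≠ X := by
    rintro P Q hQ ⟨y, hy⟩ h
    exact Finset.disjoint_right.1 hd (hQ hy) (h ▸ Finset.mem_union_right _ hy)
  have nz : ∀ x ∈ X, ∀ y ∈ Y, T x y ≠ 0 := by
    intro x hx y hy
    have h1 := hex x hx y hy
    have hx1 : ({x} : Finset α) ⊆ X := by simpa using hx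
    have hy1 : ({y} : Finset α) ⊆ Y := by simpa using hy
    rw [insert_erase_eq, hvv _ (hsubP _ hx1 _ hy1) (hcardP _ hx1 _ hy1 (by simp))
      (hneP _ _ hy1 (by simp)), cr _ hx1 _ hy1] at h1
    exact columnsIndep_singleton.1 h1
  set b : α → α → ZMod 3 := fun x y => lg (T x y) with hb
  set w := ternaryVector X e b with hw
  have hwX := (linearIndepOn_ternaryVector_iff (b := b) he hd (P := {e}) (by simpa using he)
    (by simp) (Finset.empty_subset Y))
  have crw : ∀ P ⊆ X, P.Nonempty → ∀ Q ⊆ Y,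
      (LinearIndepOn (ZMod 3) w ((X \ P ∪ Q : Finset α) : Set α) ↔ ColumnsAffineIndep b P Q) :=
    fun P hP hPne Q hQ => (linearIndepOn_ternaryVector_iff he hd hP hPne hQ).2.2
  have hWr : X.card = Module.finrank (ZMod 3) ((↥(X.erase e) → ZMod 3) × ZMod 3) := by
    rw [Module.finrank_prod, Module.finrank_fintype_fun_eq_card, Module.finrank_self,
      Fintype.card_coe, Finset.card_erase_add_one he]
  have main : ∀ n, ∀ P ⊆ X, ∀ Q ⊆ Y, P.card = n → Q.card = n →
      (LinearIndepOn Relax.GF4 v ((X \ P ∪ Q : Finset α) : Set α) ↔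
        LinearIndepOn (ZMod 3) w ((X \ P ∪ Q : Finset α) : Set α)) := by
    intro n
    induction n using Nat.strong_induction_on with
    | _ n ih =>
    intro P hP Q hQ hPn hQn
    rcases Nat.lt_or_ge n 3 with hn | hn
    · interval_cases n
      · rw [Finset.card_eq_zero] at hPn hQn
        subst hPn hQn
        rw [Finset.sdiff_empty, Finset.union_empty]
        exact ⟨fun h => absurd h hX, fun h => absurd h hwX.2.1⟩
      · rw [crw P hP (Finset.card_pos.1 (by omega)) Q hQ]
        obtain ⟨x, rfl⟩ := Finset.card_eq_one.1 hPn
        obtain ⟨y, rfl⟩ := Finset.card_eq_one.1 hQn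
        rw [← insert_erase_eq]
        refine ⟨fun _ c hc _ => by simpa using hc, fun _ => hex x ?_ y ?_⟩
        · simpa using hP
        · simpa using hQ
      · rw [hvv _ (hsubP _ hP _ hQ) (hcardP _ hP _ hQ (by omega))
          (hneP _ _ hQ (Finset.card_pos.1 (by omega))), cr _ hP _ hQ,
          crw P hP (Finset.card_pos.1 (by omega)) Q hQ]
        obtain ⟨x, x', hxx, rfl⟩ := Finset.card_eq_two.1 hPn
        obtain ⟨y, y', hyy, rfl⟩ := Finset.card_eq_two.1 hQn
        have hx : x ∈ X := hP (by simp)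
        have hx' : x' ∈ X := hP (by simp)
        have hy : y ∈ Y := hQ (by simp)
        have hy' : y' ∈ Y := hQ (by simp)
        rw [columnsIndep_pair hyy (nz x hx y hy), columnsAffineIndep_pair hyy]
        refine not_iff_not.2 ?_
        rw [← hElg _ (nz x hx y hy), ← hElg _ (nz x' hx' y' hy'), ← hElg _ (nz x hx y' hy'),
          ← hElg _ (nz x' hx' y hy), ← hEadd, ← hEadd]
        simp only [hb]
        constructor
        · intro h
          have := congrArg lg h
          rw [hlgE, hlgE] at this
          linear_combination this
        · intro h
          congr 1
          linear_combination h
    · have hdPQ : Disjoint P Q := hd.mono hP hQ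
      obtain ⟨p, hp⟩ := Finset.card_pos.1 (show 0 < P.card by omega)
      have hsp : X \ P ⊆ X.erase p := fun z hz => by
        have := Finset.mem_sdiff.1 hz
        exact Finset.mem_erase.2 ⟨fun h => this.2 (h ▸ hp), this.1⟩
      have iv : LinearIndepOn Relax.GF4 v ((X \ P : Finset α) : Set α) :=
        (hex p (hP hp) y₀ hy₀).mono (by
          exact_mod_cast hsp.trans (Finset.subset_insert _ _))
      have iv' : LinearIndepOn Relax.GF4 v' ((X \ P : Finset α) : Set α) :=
        hX'.mono (by exact_mod_cast Finset.sdiff_subset)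
      have iw : LinearIndepOn (ZMod 3) w ((X \ P : Finset α) : Set α) :=
        (hwX.1 p (hP hp)).mono (by exact_mod_cast hsp)
      have hcXP : (X \ P).card + n = X.card := by
        rw [← hPn, Finset.card_sdiff_add_card_eq_card hP]
      have disj : ∀ S ⊆ P ∪ Q, Disjoint ((X \ P : Finset α) : Set α) (S : Set α) := by
        intro S hS
        rw [Finset.disjoint_coe]
        refine Finset.disjoint_of_subset_right hS (Finset.disjoint_union_right.2
          ⟨Finset.sdiff_disjoint, ?_⟩)
        exact Finset.disjoint_of_subset_left Finset.sdiff_subset (hd.mono_right hQ)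
      have q := fun S (hS : S ⊆ P ∪ Q) => iv.quotient_iff_union (disj S hS)
      have q' := fun S (hS : S ⊆ P ∪ Q) => iv'.quotient_iff_union (disj S hS)
      have qw := fun S (hS : S ⊆ P ∪ Q) => iw.quotient_iff_union (disj S hS)
      have hrew := fun S (hS : S ⊆ P ∪ Q) => sdiff_union_eq hP hS
      have hcardS := fun S (hS : S ⊆ P ∪ Q) (hSn : S.card = n) =>
        card_sdiff_eq_card_inter hdPQ hS (hSn.trans hPn.symm)
      have hPX : X \ P ∪ P = X := Finset.sdiff_union_of_subset hP
      have key := linearIndepOn_iff_of_relaxed (R := P) (Q := Q)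
        (v := Submodule.mkQ (Submodule.span Relax.GF4 (v '' ((X \ P : Finset α) : Set α))) ∘ v)
        (v' := Submodule.mkQ (Submodule.span Relax.GF4 (v' '' ((X \ P : Finset α) : Set α))) ∘ v')
        (w := Submodule.mkQ (Submodule.span (ZMod 3) (w '' ((X \ P : Finset α) : Set α))) ∘ w)
        hdPQ (by omega) (by omega)
        (by have := finrank_quotient_span iv; omega)
        (by have := finrank_quotient_span iv'; omega)
        (by have := finrank_quotient_span iw; omega)
        (by
          intro S hS hSc hSP
          rw [q S hS, q' S hS, ← Finset.coe_union, hrew S hS]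
          refine hvv _ ?_ ?_ ?_
          · exact hsubP _ (Finset.sdiff_subset.trans hP) _ (Finset.inter_subset_right.trans hQ)
          · exact hcardP _ (Finset.sdiff_subset.trans hP) _ (Finset.inter_subset_right.trans hQ)
              (hcardS S hS (by omega))
          · refine hneP _ _ (Finset.inter_subset_right.trans hQ) ?_
            rw [Finset.nonempty_iff_ne_empty]
            intro h0
            apply hSP
            refine Finset.eq_of_subset_of_card_le (fun z hz => ?_) (by omega)
            rcases Finset.mem_union.1 (hS hz) with h | h
            · exact h
            · have : z ∈ S ∩ Q := Finset.mem_inter.2 ⟨hz, h⟩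
              rw [h0] at this
              simp at this)
        (by
          intro S hS hSc hSQ hSP
          rw [q S hS, qw S hS, ← Finset.coe_union, hrew S hS]
          refine ih (S ∩ Q).card ?_ _ (Finset.sdiff_subset.trans hP) _
            (Finset.inter_subset_right.trans hQ) (hcardS S hS (by omega)) rfl
          by_contra hlt
          apply hSQ
          have h1 : S ∩ Q = Q := Finset.eq_of_subset_of_card_le Finset.inter_subset_right
            (by omega)
          exact (Finset.eq_of_subset_of_card_le (Finset.inter_eq_right.1 h1) (by omega)).symm)
        (by rw [q P Finset.subset_union_left, ← Finset.coe_union, hPX]; exact hX)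
        (by rw [q' P Finset.subset_union_left, ← Finset.coe_union, hPX]; exact hX')
        (by
          intro x hx y hy
          have hs : insert y (P.erase x) ⊆ P ∪ Q := by
            intro z hz
            rcases Finset.mem_insert.1 hz with rfl | hz
            · exact Finset.mem_union_right _ hy
            · exact Finset.mem_union_left _ (Finset.mem_of_mem_erase hz)
          rw [q _ hs, ← Finset.coe_union]
          refine (hex x (hP hx) y (hQ hy)).mono ?_
          rw [Finset.coe_subset]
          intro z hz
          simp only [Finset.mem_union, Finset.mem_sdiff, Finset.mem_insert,
            Finset.mem_erase] at hz ⊢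
          rcases hz with hz | hz | hz
          · exact Or.inr ⟨fun h => hz.2 (h ▸ hx), hz.1⟩
          · exact Or.inl hz
          · exact Or.inr ⟨hz.1, hP hz.2⟩)
      rw [q Q Finset.subset_union_right, qw Q Finset.subset_union_right, ← Finset.coe_union] at key
      exact key
  obtain ⟨w', hw'⟩ := exists_linearIndepOn_iff_fin (K := ZMod 3) w
  refine ⟨_, w', hWr.symm, fun S hS hSc => ?_⟩
  have h1 := sdiff_union_eq subset_rfl hS
  rw [Finset.sdiff_self, Finset.empty_union] at h1
  rw [hw', h1]
  exact main _ _ Finset.sdiff_subset _ Finset.inter_subset_right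
    (card_sdiff_eq_card_inter hd hS hSc) rfl

end Ternary

section Representation

variable {α : Type*} {K V : Type*} [Field K] [AddCommGroup V] [Module K V] {M : Matroid α}

/-- The vectors `v e` represent the matroid `M`. -/
def Represents (K : Type*) [Field K] {V : Type*} [AddCommGroup V] [Module K V]
    (M : Matroid α) (v : α → V) : Prop :=
  ∀ I ⊆ M.E, (M.Indep I ↔ LinearIndepOn K v I)

lemma Represents.representable [FiniteDimensional K V] {v : α → V} (hv : Represents K M v) :
    Relax.Representable M K := by
  obtain ⟨w, hw⟩ := exists_linearIndepOn_iff_fin (K := K) v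
  exact ⟨_, w, fun I hI => (hv I hI).trans (hw I).symm⟩

lemma Represents.mem_span_of_isBasis {v : α → V} (hv : Represents K M v) {B S : Set α}
    (hB : M.IsBasis B S) {e : α} (he : e ∈ S) : v e ∈ Submodule.span K (v '' B) := by
  by_contra h
  have heB : e ∉ B := fun hB => h (Submodule.subset_span (mem_image_of_mem v hB))
  have h1 : LinearIndepOn K v (insert e B) :=
    (linearIndepOn_insert heB).2 ⟨(hv B (hB.subset.trans hB.subset_ground)).1 hB.indep, h⟩
  have h2 : M.Indep (insert e B) :=
    (hv _ (insert_subset (hB.subset_ground he) (hB.subset.trans hB.subset_ground))).2 h1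
  exact heB (hB.mem_of_insert_indep he h2)

lemma Represents.spanning_iff {v : α → V} (hv : Represents K M v) {S : Set α} (hS : S ⊆ M.E) :
    M.Spanning S ↔ ∀ e ∈ M.E, v e ∈ Submodule.span K (v '' S) := by
  constructor
  · intro h e he
    obtain ⟨B, hB⟩ := M.exists_isBasis S
    exact Submodule.span_mono (image_mono hB.subset)
      (hv.mem_span_of_isBasis (hB.isBase_of_spanning h).isBasis_ground he)
  · intro h
    obtain ⟨B, hB⟩ := M.exists_isBasis S
    refine (IsBase.spanning ?_).superset hB.subset
    refine hB.indep.isBase_of_forall_insert fun e he hi => ?_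
    rw [hv _ hi.subset_ground, linearIndepOn_insert he.2] at hi
    refine hi.2 (?_ : v e ∈ Submodule.span K (v '' B))
    have := h e he.1
    refine Submodule.span_le.2 ?_ this
    rintro _ ⟨f, hf, rfl⟩
    exact hv.mem_span_of_isBasis hB hf

lemma Relax.Representable.restrict (h : Relax.Representable M K) {R : Set α} (hR : R ⊆ M.E) :
    Relax.Representable (M ↾ R) K := by
  obtain ⟨n, v, hv⟩ := h
  refine ⟨n, v, fun I hI => ?_⟩
  rw [restrict_indep_iff, hv I (subset_trans hI hR)]
  exact and_iff_left hI

/-- A vector lies in the span of a family iff all functionals vanishing on the family vanish on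
the vector. -/
lemma mem_span_iff_forall_dual {x : V} {s : Set V} :
    x ∈ Submodule.span K s ↔ ∀ f : Module.Dual K V, (∀ y ∈ s, f y = 0) → f x = 0 := by
  constructor
  · intro hx f hf
    have : Submodule.span K s ≤ LinearMap.ker f := Submodule.span_le.2 hf
    exact this hx
  · intro h
    rw [← Subspace.dualAnnihilator_dualCoannihilator_eq (W := Submodule.span K s),
      Submodule.mem_dualCoannihilator]
    intro f hf
    rw [Submodule.mem_dualAnnihilator] at hf
    exact h f fun y hy => hf y (Submodule.subset_span hy)

lemma Relax.Representable.dual (hfin : M.E.Finite) (h : Relax.Representable M K) :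
    Relax.Representable M✶ K := by
  obtain ⟨n, v, hv⟩ := h
  have hv : Represents K M v := hv
  have := hfin.fintype
  let L : (M.E → K) →ₗ[K] (Fin n → K) := Fintype.linearCombination K (fun e : M.E => v e)
  have hL : ∀ (f : Module.Dual K (Fin n → K)) (g : M.E → K),
      f (L g) = ∑ e : M.E, g e * f (v e) := by
    intro f g
    simp [L, Fintype.linearCombination_apply, map_sum]
  let w : α → Module.Dual K (LinearMap.ker L) := fun e =>
    if he : e ∈ M.E then (LinearMap.proj (⟨e, he⟩ : M.E)) ∘ₗ (LinearMap.ker L).subtype else 0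
  refine Represents.representable (v := w) fun I hI => ?_
  rw [dual_ground] at hI
  have h1 : M✶.Indep I ↔ M.Spanning (M.E \ I) := coindep_iff_compl_spanning hI
  rw [h1, hv.spanning_iff sdiff_subset]
  have hIf : I.Finite := hfin.subset hI
  obtain ⟨J, rfl⟩ : ∃ J : Finset α, I = J := ⟨hIf.toFinset, by simp⟩
  have hw : ∀ (c : α → K) (g : LinearMap.ker L), (∑ e ∈ J, c e • w e) g =
      ∑ e : M.E, (if (e : α) ∈ J then c e else 0) * g.1 e := by
    intro c g
    rw [LinearMap.sum_apply]
    rw [← Finset.sum_subtype_of_mem (p := (· ∈ M.E)) _ (fun e he => hI he),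
      ← Finset.sum_subset (Finset.subset_univ (J.subtype (· ∈ M.E)))]
    · refine Finset.sum_congr rfl fun e he => ?_
      simp [w, Finset.mem_subtype.1 he]
    · intro e _ he
      simp_all [Finset.mem_subtype]
  rw [linearIndepOn_finset_iff]
  constructor
  · intro h c hc
    let F : Module.Dual K (M.E → K) :=
      ∑ e : M.E, (if (e : α) ∈ J then c e else 0) • LinearMap.proj e
    have hF : F ∈ (LinearMap.ker L).dualAnnihilator := by
      rw [Submodule.mem_dualAnnihilator]
      intro g hg
      have := hw c ⟨g, hg⟩
      rw [hc] at this
      simpa [F, LinearMap.sum_apply, LinearMap.smul_apply, -ite_smul] using this.symm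
    rw [← LinearMap.range_dualMap_eq_dualAnnihilator_ker] at hF
    obtain ⟨f, hf⟩ := hF
    have hfe : ∀ e : M.E, f (v e) = if (e : α) ∈ J then c e else 0 := by
      intro e
      have h2 := congrArg (fun G => G (Pi.single e 1)) hf
      simp only [LinearMap.dualMap_apply, hL] at h2
      simpa [F, LinearMap.sum_apply, LinearMap.smul_apply, -ite_smul, Pi.single_apply] using h2
    intro e he
    have := mem_span_iff_forall_dual.1 (h e (hI he)) f (by
      rintro _ ⟨e', he', rfl⟩
      rw [hfe ⟨e', he'.1⟩]
      exact if_neg he'.2)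
    rwa [hfe ⟨e, hI he⟩, if_pos he] at this
  · intro h e he
    rw [mem_span_iff_forall_dual]
    intro f hf
    by_cases heJ : e ∈ J
    · refine h (fun e => f (v e)) ?_ e heJ
      ext g
      rw [hw]
      have h2 := hL f g.1
      rw [LinearMap.mem_ker.1 g.2, map_zero] at h2
      rw [LinearMap.zero_apply]
      refine Eq.trans ?_ h2.symm
      refine Finset.sum_congr rfl fun e' _ => ?_
      split_ifs with h'
      · ring
      · rw [hf _ (mem_image_of_mem v ⟨e'.2, h'⟩)]; ring
    · exact hf _ (mem_image_of_mem v ⟨he, heJ⟩)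

lemma Relax.Representable.minor (hfin : M.E.Finite)
    (h : Relax.Representable M K) {C D : Set α} :
    Relax.Representable ((M ／ C) ＼ D) K := by
  refine Relax.Representable.restrict ?_ sdiff_subset
  refine Relax.Representable.dual (M := M✶ ＼ C) (hfin.subset sdiff_subset) ?_
  exact (h.dual hfin).restrict sdiff_subset

/-- It suffices to compare sets of full rank. -/
lemma represents_of_isBase [FiniteDimensional K V] {v : α → V} (hfin : M.E.Finite)
    {B : Set α} (hB : M.IsBase B) (hr : B.ncard = Module.finrank K V)
    (h : ∀ S ⊆ M.E, S.ncard = B.ncard → (M.Indep S ↔ LinearIndepOn K v S)) :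
    Represents K M v := by
  intro I hI
  constructor
  · intro hi
    obtain ⟨B', hB', hIB⟩ := hi.exists_isBase_superset
    exact ((h B' hB'.subset_ground (hB'.ncard_eq_ncard_of_isBase hB)).1 hB'.indep).mono hIB
  · intro hi
    have hBv := (h B hB.subset_ground rfl).1 hB.indep
    obtain ⟨J, hJs, hIJ, hsp, hJ⟩ := exists_linearIndepOn_extension (hi) (t := I ∪ B)
      subset_union_left
    have hJE : J ⊆ M.E := hJs.trans (union_subset hI hB.subset_ground)
    have hJf := hfin.subset hJE
    have hBf := hfin.subset hB.subset_ground
    have hspan : ⊤ ≤ Submodule.span K (v '' J) := by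
      have h1 : Submodule.span K (v '' B) = ⊤ := by
        have := hBf.fintype
        rw [image_eq_range]
        refine LinearIndependent.span_eq_top_of_card_eq_finrank' hBv ?_
        rw [← hr, ← Nat.card_coe_set_eq, Nat.card_eq_fintype_card]
      rw [← h1, Submodule.span_le]
      exact (image_mono subset_union_right).trans hsp
    have hJc : J.ncard = B.ncard := by
      have := hJf.fintype
      rw [hr, ← finrank_top (R := K), ← top_le_iff.1 hspan, image_eq_range,
        finrank_span_eq_card hJ, ← Nat.card_coe_set_eq, Nat.card_eq_fintype_card]
    exact ((h J hJE hJc).2 hJ).subset hIJ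

lemma Relax.Representable.exists_represents_fin (hfin : M.E.Finite)
    (h : Relax.Representable M K) {B : Set α} (hB : M.IsBase B) :
    ∃ v : α → (Fin B.ncard → K), Represents K M v := by
  obtain ⟨n, v, hv⟩ := h
  have hv : Represents K M v := hv
  let U := Submodule.span K (v '' M.E)
  let u : α → U := fun e => if he : e ∈ M.E then ⟨v e, Submodule.subset_span ⟨e, he, rfl⟩⟩ else 0
  have hu : Represents K M u := by
    intro I hI
    rw [hv I hI, ← LinearMap.linearIndepOn_iff_of_injOn (f := U.subtype) (by simp)]
    refine linearIndepOn_congr ?_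
    intro e he
    simp [u, hI he]
  have hr : Module.finrank K U = B.ncard := by
    have := (hfin.subset hB.subset_ground).fintype
    have h1 : U = Submodule.span K (v '' B) := by
      refine le_antisymm (Submodule.span_le.2 ?_) (Submodule.span_mono (image_mono hB.subset_ground))
      rintro _ ⟨e, he, rfl⟩
      exact hv.mem_span_of_isBasis hB.isBasis_ground he
    rw [h1, image_eq_range,
        finrank_span_eq_card ((hv B hB.subset_ground).1 hB.indep), ← Nat.card_coe_set_eq,
        Nat.card_eq_fintype_card]
  obtain ⟨w, hw⟩ : ∃ w : α → (Fin B.ncard → K), ∀ S : Set α,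
      LinearIndepOn K w S ↔ LinearIndepOn K u S := hr ▸ exists_linearIndepOn_iff_fin (K := K) u
  exact ⟨w, fun I hI => (hu I hI).trans (hw I).symm⟩

end Representation

section Relaxation

variable {α : Type*} {M M' N : Matroid α} {X : Set α}

/-- The independent sets of `M` are those of `N` and the set `X`, which is dependent in `N`. -/
structure RelaxedAt (N M : Matroid α) (X : Set α) : Prop where
  ground_eq : N.E = M.E
  subset_ground : X ⊆ M.E
  not_indep : ¬ N.Indep X
  indep_iff : ∀ S, M.Indep S ↔ N.Indep S ∨ S = X

lemma Relax.CircuitHyperplane.isBase_exchange (h : Relax.CircuitHyperplane M X) {x y : α}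
    (hx : x ∈ X) (hy : y ∈ M.E \ X) : M.IsBase (insert y (X \ {x})) := by
  obtain ⟨⟨hdep, hind⟩, hflat, hne, hmax⟩ := h
  have hss : X \ {x} ⊂ X := sdiff_singleton_ssubset.2 hx
  have hi : M.Indep (X \ {x}) := hind _ hss
  have hyc : y ∉ M.closure (X \ {x}) := fun h => hy.2 <| by
    have := M.closure_subset_closure hss.subset h
    rwa [hflat.closure] at this
  have hXc : X ⊆ M.closure (X \ {x}) := by
    intro z hz
    by_cases hzx : z = x
    · rw [hi.mem_closure_iff]
      subst hzx
      exact Or.inl (by rwa [insert_sdiff_singleton, insert_eq_of_mem hz])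
    · exact M.mem_closure_of_mem ⟨hz, hzx⟩ hi.subset_ground
  have hi' : M.Indep (insert y (X \ {x})) :=
    (hi.notMem_closure_iff_of_notMem (fun h => hy.2 h.1) hy.1).1 hyc
  refine hi'.isBase_of_ground_subset_closure ?_
  have h1 : X ⊂ M.closure (insert y (X \ {x})) := by
    refine ssubset_of_subset_of_ne (hXc.trans (M.closure_subset_closure (subset_insert _ _))) ?_
    rintro h
    exact hy.2 (h ▸ M.mem_closure_of_mem (mem_insert _ _) hi'.subset_ground)
  exact (hmax _ (M.isFlat_closure _) h1).ge

lemma Relax.CircuitHyperplane.nonempty (h : Relax.CircuitHyperplane M X) : X.Nonempty :=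
  h.1.1.nonempty

lemma Relax.CircuitHyperplane.subset_ground (h : Relax.CircuitHyperplane M X) : X ⊆ M.E :=
  h.1.1.subset_ground

lemma Relax.CircuitHyperplane.compl_nonempty (h : Relax.CircuitHyperplane M X) :
    (M.E \ X).Nonempty :=
  sdiff_nonempty.2 fun hE => h.2.2.1 (h.subset_ground.antisymm hE)

lemma Relax.CircuitHyperplane.ncard_eq (h : Relax.CircuitHyperplane M X) {B : Set α}
    (hB : M.IsBase B) : B.ncard = X.ncard := by
  obtain ⟨x, hx⟩ := h.nonempty
  obtain ⟨y, hy⟩ := h.compl_nonempty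
  rw [hB.ncard_eq_ncard_of_isBase (h.isBase_exchange hx hy)]
  exact ncard_exchange hy.2 hx

lemma Relax.IsRelaxation.relaxedAt (h : Relax.IsRelaxation M M' X) : RelaxedAt M M' X := by
  obtain ⟨hX, hE, hB⟩ := h
  refine ⟨hE.symm, hE ▸ hX.subset_ground, hX.1.1.not_indep, fun S => ⟨fun hS => ?_, ?_⟩⟩
  · obtain ⟨B, hB', hSB⟩ := hS.exists_isBase_superset
    rcases (hB B).1 hB' with hB' | rfl
    · exact Or.inl (hB'.indep.subset hSB)
    · rcases hSB.eq_or_ssubset with rfl | h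
      · exact Or.inr rfl
      · exact Or.inl (hX.1.2 _ h)
  · rintro (hS | rfl)
    · obtain ⟨B, hB', hSB⟩ := hS.exists_isBase_superset
      exact ((hB B).2 (Or.inl hB')).indep.subset hSB
    · exact ((hB S).2 (Or.inr rfl)).indep

lemma Relax.IsRelaxation.relaxedAt_dual (hfin : M.E.Finite) (h : Relax.IsRelaxation M M' X) :
    RelaxedAt M✶ M'✶ (M.E \ X) := by
  obtain ⟨hX, hE, hB⟩ := h
  have hXE := hX.subset_ground
  have hdual : ∀ S ⊆ M.E, (M'✶.Indep S ↔ M✶.Indep S ∨ Disjoint S X) := by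
    intro S hS
    rw [dual_indep_iff_exists', dual_indep_iff_exists', hE]
    simp only [hS, true_and, hB]
    constructor
    · rintro ⟨B, hB' | rfl, hd⟩
      exacts [Or.inl ⟨B, hB', hd⟩, Or.inr hd]
    · rintro (⟨B, hB', hd⟩ | hd)
      exacts [⟨B, Or.inl hB', hd⟩, ⟨X, Or.inr rfl, hd⟩]
  refine ⟨hE.symm, hE ▸ sdiff_subset, fun hi => ?_, fun S => ?_⟩
  · obtain ⟨-, B, hB', hd⟩ := dual_indep_iff_exists'.1 hi
    have hBX : B ⊆ X := fun z hz => by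
      by_contra hzX
      exact hd.le_bot ⟨⟨hB'.subset_ground hz, hzX⟩, hz⟩
    have := eq_of_subset_of_ncard_le hBX (hX.ncard_eq hB').ge (hfin.subset hXE)
    exact hX.1.1.not_indep (this ▸ hB'.indep)
  · by_cases hS : S ⊆ M.E
    · rw [hdual S hS]
      refine ⟨?_, ?_⟩
      · rintro (h | h)
        · exact Or.inl h
        · by_cases hSX : S = M.E \ X
          · exact Or.inr hSX
          · have : ∃ y ∈ M.E \ X, y ∉ S := by
              by_contra! hc
              exact hSX (Subset.antisymm (subset_sdiff.2 ⟨hS, h⟩) hc)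
            obtain ⟨y, hy, hyS⟩ := this
            obtain ⟨x, hx⟩ := hX.nonempty
            refine Or.inl (dual_indep_iff_exists'.2 ⟨hS, _, hX.isBase_exchange hx hy, ?_⟩)
            rw [disjoint_insert_right]
            exact ⟨hyS, h.mono_right sdiff_subset⟩
      · rintro (h | rfl)
        · exact Or.inl h
        · exact Or.inr disjoint_sdiff_left
    · constructor
      · intro h; exact absurd (h.subset_ground.trans (by simp [hE])) hS
      · rintro (h | rfl)
        · exact absurd h.subset_ground hS
        · exact absurd sdiff_subset hS

/-- A matroid that is quaternary before and after relaxing a circuit-hyperplane is ternary. -/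
theorem Relax.IsRelaxation.representable_ternary (hfin : M.E.Finite)
    (h : Relax.IsRelaxation M M' X) (hM : Relax.Representable M Relax.GF4)
    (hM' : Relax.Representable M' Relax.GF4) : Relax.Representable M (ZMod 3) := by
  have hrel := h.relaxedAt
  obtain ⟨hX, hE, hB⟩ := h
  have hXE := hX.subset_ground
  obtain ⟨x₀, hx₀⟩ := hX.nonempty
  obtain ⟨y₀, hy₀⟩ := hX.compl_nonempty
  have hB₀ := hX.isBase_exchange hx₀ hy₀
  have hX' : M'.IsBase X := (hB X).2 (Or.inr rfl)
  obtain ⟨v, hv⟩ := hM.exists_represents_fin hfin hB₀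
  obtain ⟨v', hv'⟩ := hM'.exists_represents_fin (hE ▸ hfin) hX'
  have hc₀ := hX.ncard_eq hB₀
  obtain ⟨S, rfl⟩ : ∃ S : Finset α, X = S := ⟨(hfin.subset hXE).toFinset, by simp⟩
  obtain ⟨T, hT⟩ : ∃ T : Finset α, M.E \ S = T :=
    ⟨(hfin.subset (sdiff_subset : M.E \ ↑S ⊆ M.E)).toFinset, (Finite.coe_toFinset _).symm⟩
  have hE' : M.E = ↑(S ∪ T) := by rw [Finset.coe_union, ← hT, union_sdiff_cancel hXE]
  rw [ncard_coe_finset] at hc₀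
  have hd : Disjoint S T := by
    rw [← Finset.disjoint_coe, ← hT]; exact disjoint_sdiff_right
  obtain ⟨n, w, hn, hw⟩ := exists_ternary_of_relaxed (v := v) (v' := v') hd hX.nonempty
    (by rw [← Finset.coe_nonempty, ← hT]; exact ⟨y₀, hy₀⟩) (by simp [hc₀]) (by simp)
    (by
      intro Q hQ hQc hne
      have hQE : (Q : Set α) ⊆ M.E := by rw [hE']; exact_mod_cast hQ
      rw [← hv Q hQE, ← hv' Q (hE ▸ hQE), hrel.indep_iff]
      simp [hne])
    (by rw [← hv S hXE]; exact hrel.not_indep)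
    (by rw [← hv' S (hE ▸ hXE)]; exact hX'.indep)
    (by
      intro x hx y hy
      have hy' : y ∈ M.E \ S := by rw [hT]; exact hy
      have := hX.isBase_exchange hx hy'
      rw [Finset.coe_insert, Finset.coe_erase]
      exact (hv _ this.subset_ground).1 this.indep)
  refine (represents_of_isBase (v := w) hfin hB₀ (by simp [hc₀, hn]) ?_).representable
  intro Q hQ hQc
  obtain ⟨R, rfl⟩ : ∃ R : Finset α, Q = R := ⟨(hfin.subset hQ).toFinset, by simp⟩
  have hRS : R ⊆ S ∪ T := by rw [hE'] at hQ; exact_mod_cast hQ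
  have hc : R.card = S.card := by rw [← ncard_coe_finset, hQc, hc₀]
  rw [← hw R hRS hc]
  exact hv _ hQ

lemma RelaxedAt.delete (h : RelaxedAt N M X) {D : Set α} (hD : Disjoint X D) :
    RelaxedAt (N ＼ D) (M ＼ D) X where
  ground_eq := by simp [h.ground_eq]
  subset_ground := subset_sdiff.2 ⟨h.subset_ground, hD⟩
  not_indep := fun hi => h.not_indep (delete_indep_iff.1 hi).1
  indep_iff := fun S => by
    simp only [delete_indep_iff, h.indep_iff]
    constructor
    · rintro ⟨h | h, hd⟩
      exacts [Or.inl ⟨h, hd⟩, Or.inr h]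
    · rintro (h | rfl)
      exacts [⟨Or.inl h.1, h.2⟩, ⟨Or.inr rfl, hD⟩]

lemma RelaxedAt.delete_eq (h : RelaxedAt N M X) {D : Set α} (hD : ¬ Disjoint X D) :
    M ＼ D = N ＼ D := by
  refine ext_indep (by simp [h.ground_eq]) fun S _ => ?_
  simp only [delete_indep_iff, h.indep_iff]
  constructor
  · rintro ⟨h | rfl, hd⟩
    exacts [⟨h, hd⟩, absurd hd hD]
  · rintro h
    exact ⟨Or.inl h.1, h.2⟩

lemma RelaxedAt.contract (h : RelaxedAt N M X) {C : Set α} (hC : C ⊂ X) :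
    RelaxedAt (N ／ C) (M ／ C) (X \ C) := by
  have hX : M.Indep X := (h.indep_iff X).2 (Or.inr rfl)
  have hCM : M.Indep C := hX.subset hC.subset
  have hCN : N.Indep C := by
    rcases (h.indep_iff C).1 hCM with h | h
    exacts [h, absurd h hC.ne]
  have hXC : X \ C ∪ C = X := sdiff_union_of_subset hC.subset
  refine ⟨by simp [h.ground_eq], sdiff_subset_sdiff_left h.subset_ground, fun hi => ?_,
    fun S => ?_⟩
  · rw [hCN.contract_indep_iff, hXC] at hi
    exact h.not_indep hi.2
  · rw [hCN.contract_indep_iff, hCM.contract_indep_iff, h.indep_iff]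
    constructor
    · rintro ⟨hd, h | h⟩
      · exact Or.inl ⟨hd, h⟩
      · right
        rw [← h, union_sdiff_right]
        exact (sdiff_eq_left.2 hd).symm
    · rintro (h | rfl)
      exacts [⟨h.1, Or.inl h.2⟩, ⟨disjoint_sdiff_left, Or.inr hXC⟩]

/-- A minor of a relaxation is ternary, or is itself obtained by adding one independent set to a
matroid that is both ternary and quaternary. -/
theorem RelaxedAt.minor_cases (hfin : M.E.Finite) (h : RelaxedAt M M' X)
    (h' : RelaxedAt M✶ M'✶ (M.E \ X)) (h₃ : Relax.Representable M (ZMod 3))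
    (h₄ : Relax.Representable M Relax.GF4) {C D : Set α} (hC : C ⊆ M'.E) :
    Relax.Representable ((M' ／ C) ＼ D) (ZMod 3) ∨
    ∃ N Y, RelaxedAt N ((M' ／ C) ＼ D) Y ∧ Relax.Representable N (ZMod 3) ∧
      Relax.Representable N Relax.GF4 := by
  by_cases hCX : C ⊆ X
  · rcases hCX.eq_or_ssubset with rfl | hss
    · left
      have hCi : M'.Indep C := (h.indep_iff C).2 (Or.inr rfl)
      refine Relax.Representable.restrict ?_ sdiff_subset
      refine ⟨0, fun _ => 0, fun S hS => ?_⟩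
      have h2 : (M' ／ C).Indep S ↔ S = ∅ := by
        rw [hCi.contract_indep_iff]
        constructor
        · rintro ⟨hd, hi⟩
          rcases (h.indep_iff _).1 hi with hi | hi
          · exact absurd (hi.subset subset_union_right) h.not_indep
          · have := subset_union_left.trans hi.subset
            exact disjoint_self.1 (hd.mono_right this)
        · rintro rfl
          simpa using hCi
      rw [h2]
      constructor
      · rintro rfl
        exact linearIndependent_empty_type
      · intro hi
        by_contra hne
        obtain ⟨s, hs⟩ := nonempty_iff_ne_empty.2 hne
        exact hi.ne_zero ⟨s, hs⟩ rfl
    · have h1 := h.contract hss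
      by_cases hD : Disjoint (X \ C) D
      · exact Or.inr ⟨_, _, h1.delete hD, h₃.minor hfin, h₄.minor hfin⟩
      · rw [h1.delete_eq hD]
        exact Or.inl (h₃.minor hfin)
  · left
    have h1 : M'✶ ＼ C = M✶ ＼ C := h'.delete_eq fun hd => hCX fun z hz => by
      by_contra hzX
      exact hd.le_bot ⟨⟨h.ground_eq ▸ hC hz, hzX⟩, hz⟩
    have h2 : M' ／ C = M ／ C := congrArg (fun N => N✶) h1
    rw [h2]
    exact h₃.minor hfin

end Relaxation

section FivePointLine

variable {ι V : Type*} [AddCommGroup V] [Module (ZMod 3) V]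

/-- There are at most four pairwise independent vectors in a ternary plane. -/
lemma false_of_ternary_line {u : ι → V} {J : Finset ι} (hJ : 4 < J.card)
    (h₂ : ∀ T ⊆ J, T.card = 2 → LinearIndepOn (ZMod 3) u (T : Set ι))
    (h₃ : ∀ T ⊆ J, T.card = 3 → ¬ LinearIndepOn (ZMod 3) u (T : Set ι)) : False := by
  obtain ⟨x, hx, y, hy, hxy⟩ := Finset.one_lt_card.1 (show 1 < J.card by omega)
  have hpair : ∀ z ∈ J, ∀ z' ∈ J, z ≠ z' → ∀ s t : ZMod 3, s • u z + t • u z' = 0 →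
      s = 0 ∧ t = 0 := by
    intro z hz z' hz' hne
    have := h₂ {z, z'} (by simp [Finset.insert_subset_iff, hz, hz']) (Finset.card_pair hne)
    rw [Finset.coe_pair] at this
    exact (LinearIndepOn.pair_iff u hne).1 this
  set R := (J.erase x).erase y with hR
  have hRmem : ∀ z ∈ R, z ≠ x ∧ z ≠ y ∧ z ∈ J := by
    intro z hz
    simp only [hR, Finset.mem_erase] at hz
    exact ⟨hz.2.1, hz.1, hz.2.2⟩
  have hRc : 2 < R.card := by
    have h1 := Finset.card_erase_of_mem hx
    have h2 : R.card = _ := Finset.card_erase_of_mem (Finset.mem_erase.2 ⟨hxy.symm, hy⟩)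
    omega
  have key : ∀ z ∈ R, ∃ p : ZMod 3 × ZMod 3, p.1 • u x + p.2 • u y = u z := by
    intro z hz
    obtain ⟨hzx, hzy, hzJ⟩ := hRmem z hz
    have h1 := h₂ {x, y} (by simp [Finset.insert_subset_iff, hx, hy]) (Finset.card_pair hxy)
    have h2 := h₃ {z, x, y} (by simp [Finset.insert_subset_iff, hx, hy, hzJ])
      (Finset.card_eq_three.2 ⟨z, x, y, hzx, hzy, hxy, rfl⟩)
    rw [Finset.coe_insert, linearIndepOn_insert (by simp [hzx, hzy]), not_and, not_not] at h2
    have h3 := h2 h1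
    rw [Finset.coe_pair, image_pair, Submodule.mem_span_pair] at h3
    obtain ⟨s, t, h⟩ := h3
    exact ⟨(s, t), h⟩
  choose! p hp using key
  have hp0 : ∀ z ∈ R, (p z).1 ≠ 0 ∧ (p z).2 ≠ 0 := by
    intro z hz
    obtain ⟨hzx, hzy, hzJ⟩ := hRmem z hz
    have h1 := hp z hz
    constructor
    · intro h0
      rw [h0, zero_smul, zero_add] at h1
      have := hpair z hzJ y hy hzy 1 (-(p z).2) (by rw [← h1]; module)
      exact one_ne_zero this.1
    · intro h0
      rw [h0, zero_smul, add_zero] at h1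
      have := hpair z hzJ x hx hzx 1 (-(p z).1) (by rw [← h1]; module)
      exact one_ne_zero this.1
  have hmaps : ∀ z ∈ R, (p z).1 * (p z).2 ∈ (Finset.univ.erase 0 : Finset (ZMod 3)) := by
    intro z hz
    have := hp0 z hz
    rw [Finset.mem_erase]
    exact ⟨mul_ne_zero this.1 this.2, Finset.mem_univ _⟩
  obtain ⟨z, hz, z', hz', hne, heq⟩ := Finset.exists_ne_map_eq_of_card_lt_of_maps_to
    (by rw [Finset.card_erase_of_mem (Finset.mem_univ _)]; simpa using hRc) hmaps
  have hcross : ∀ a b c d : ZMod 3, a ≠ 0 → b ≠ 0 → c ≠ 0 → d ≠ 0 → a * b = c * d →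
      a * d = c * b := by decide
  have h1 := hcross _ _ _ _ (hp0 z hz).1 (hp0 z hz).2 (hp0 z' hz').1 (hp0 z' hz').2 heq
  have h2 := hpair z (hRmem z hz).2.2 z' (hRmem z' hz').2.2 hne (p z').2 (-(p z).2) (by
    rw [← hp z hz, ← hp z' hz']
    calc _ = ((p z).1 * (p z').2 - (p z').1 * (p z).2) • u x := by module
      _ = 0 := by rw [h1, sub_self, zero_smul])
  exact absurd h2.1 (hp0 z' hz').2

/-- A ternary configuration has no five-point line minor. -/
lemma false_of_ternary_line_minor [DecidableEq ι] {u : ι → V} {I J : Finset ι} (hJ : 4 < J.card)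
    (hIJ : Disjoint I J)
    (h₂ : ∀ T ⊆ J, T.card = 2 → LinearIndepOn (ZMod 3) u ((I ∪ T : Finset ι) : Set ι))
    (h₃ : ∀ T ⊆ J, T.card = 3 → ¬ LinearIndepOn (ZMod 3) u ((I ∪ T : Finset ι) : Set ι)) :
    False := by
  obtain ⟨T, hT, hTc⟩ := Finset.exists_subset_card_eq (show 2 ≤ J.card by omega)
  have hI : LinearIndepOn (ZMod 3) u (I : Set ι) := (h₂ T hT hTc).mono (by simp)
  have q : ∀ T ⊆ J, LinearIndepOn (ZMod 3) u ((I ∪ T : Finset ι) : Set ι) ↔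
      LinearIndepOn (ZMod 3) ((Submodule.span (ZMod 3) (u '' (I : Set ι))).mkQ ∘ u)
        (T : Set ι) := by
    intro T hT
    rw [Finset.coe_union, hI.quotient_iff_union]
    exact Finset.disjoint_coe.2 (hIJ.mono_right hT)
  exact false_of_ternary_line hJ (fun T hT hc => (q T hT).1 (h₂ T hT hc))
    (fun T hT hc => (q T hT).not.1 (h₃ T hT hc))

end FivePointLine

section Coordinates

variable {n r : ℕ} {K : Type*} [Field K]

lemma LinearIndepOn.card_le {u : Fin n → Fin r → K} {S : Finset (Fin n)}
    (h : LinearIndepOn K u (S : Set (Fin n))) : S.card ≤ r := by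
  simpa using LinearIndependent.fintype_card_le_finrank h

lemma linearIndepOn_range_iff_det {u : Fin n → Fin r → K} {z : Fin r → Fin n}
    (hz : Function.Injective z) :
    LinearIndepOn K u (range z) ↔ Matrix.det (Matrix.of fun i => u (z i)) ≠ 0 := by
  rw [linearIndepOn_range_iff hz, ← isUnit_iff_ne_zero, ← Matrix.isUnit_iff_isUnit_det,
    ← Matrix.linearIndependent_rows_iff_isUnit]
  rfl

/-- A change of basis. -/
lemma exists_standard_coordinates {u : Fin n → Fin r → K} {z : Fin r → Fin n}
    (hz : Function.Injective z) (h : LinearIndepOn K u (range z)) :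
    ∃ w : Fin n → Fin r → K, (∀ i, w (z i) = Pi.single i 1) ∧
      ∀ S : Set (Fin n), LinearIndepOn K w S ↔ LinearIndepOn K u S := by
  rw [linearIndepOn_range_iff hz] at h
  let b := Module.Basis.mk h (h.span_eq_top_of_card_eq_finrank' (by simp)).ge
  refine ⟨fun i => b.equivFun (u i), fun i => ?_, fun S =>
    LinearMap.linearIndependent_iff (b.equivFun : (Fin r → K) →ₗ[K] (Fin r → K)) (by simp)⟩
  have : u (z i) = b i := by simp [b]
  change b.equivFun (u (z i)) = _
  rw [this]
  ext j
  simp [Pi.single_apply, eq_comm]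

lemma linearIndepOn_triple_iff {u : Fin n → Fin 3 → K} {i j k : Fin n} (hij : i ≠ j) (hik : i ≠ k)
    (hjk : j ≠ k) : LinearIndepOn K u (({i, j, k} : Finset (Fin n)) : Set (Fin n)) ↔
      Matrix.det (Matrix.of ![u i, u j, u k]) ≠ 0 := by
  have hz : Function.Injective ![i, j, k] := by
    intro a b
    fin_cases a <;> fin_cases b <;> simp [hij, hik, hjk, hij.symm, hik.symm, hjk.symm]
  have h1 : ((({i, j, k} : Finset (Fin n)) : Set (Fin n))) = range ![i, j, k] := by
    ext x; simp [eq_comm (a := x)]; tauto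
  rw [h1, linearIndepOn_range_iff_det hz]
  have : (fun a => u (![i, j, k] a)) = ![u i, u j, u k] := by
    ext a; fin_cases a <;> rfl
  rw [this]

lemma linearIndepOn_quadruple_iff {u : Fin n → Fin 4 → K} {i j k l : Fin n} (hij : i ≠ j)
    (hik : i ≠ k) (hil : i ≠ l) (hjk : j ≠ k) (hjl : j ≠ l) (hkl : k ≠ l) :
    LinearIndepOn K u (({i, j, k, l} : Finset (Fin n)) : Set (Fin n)) ↔
      Matrix.det (Matrix.of ![u i, u j, u k, u l]) ≠ 0 := by
  have hz : Function.Injective ![i, j, k, l] := by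
    intro a b
    fin_cases a <;> fin_cases b <;>
      simp [hij, hik, hil, hjk, hjl, hkl, hij.symm, hik.symm, hil.symm, hjk.symm, hjl.symm,
        hkl.symm]
  have h1 : ((({i, j, k, l} : Finset (Fin n)) : Set (Fin n))) = range ![i, j, k, l] := by
    ext x; simp [eq_comm (a := x)]; tauto
  rw [h1, linearIndepOn_range_iff_det hz]
  have : (fun a => u (![i, j, k, l] a)) = ![u i, u j, u k, u l] := by
    ext a; fin_cases a <;> rfl
  rw [this]

end Coordinates

section Labelling

lemma linearIndepOn_image_iff {ι κ K V : Type*} [Field K] [AddCommGroup V] [Module K V]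
    {v : ι → V} {h : κ → ι} (hh : Function.Injective h) {S : Set κ} :
    LinearIndepOn K v (h '' S) ↔ LinearIndepOn K (v ∘ h) S :=
  ⟨fun H => H.comp_of_image hh.injOn, fun H => H.image_of_comp _ _⟩

variable {α : Type*} {n r : ℕ} {M N : Matroid α}

/-- The elements of `M` are labelled by `h`, and its rank is at most `r`. -/
structure IsLabelling (M : Matroid α) (h : Fin n → α) (r : ℕ) : Prop where
  injective : Function.Injective h
  range_eq : range h = M.E
  card_le : ∀ S : Finset (Fin n), M.Indep (h '' S) → S.card ≤ r

lemma exists_eq_image_finset {h : Fin n → α} {X : Set α} (hX : X ⊆ range h) :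
    ∃ S : Finset (Fin n), X = h '' S :=
  ⟨(h ⁻¹' X).toFinset, by simp [image_preimage_eq_of_subset hX]⟩

lemma image_finset_injective {h : Fin n → α} (hh : Function.Injective h) {S T : Finset (Fin n)} :
    h '' (S : Set (Fin n)) = h '' (T : Set (Fin n)) ↔ S = T := by
  rw [image_eq_image hh, Finset.coe_inj]

lemma IsLabelling.isBase {h : Fin n → α} (hh : IsLabelling M h r) {S : Finset (Fin n)}
    (hS : M.Indep (h '' S)) (hSc : S.card = r) : M.IsBase (h '' S) := by
  obtain ⟨B, hB, hSB⟩ := hS.exists_isBase_superset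
  obtain ⟨T, rfl⟩ := exists_eq_image_finset (hB.subset_ground.trans hh.range_eq.ge)
  have hST : S ⊆ T := by
    have := (image_subset_image_iff hh.injective).1 hSB
    exact_mod_cast this
  have := Finset.eq_of_subset_of_card_le hST (hSc ▸ hh.card_le T hB.indep)
  rwa [this]

lemma IsLabelling.exists_vectors {h : Fin n → α} (hh : IsLabelling M h r) {S : Finset (Fin n)}
    (hS : M.Indep (h '' S)) (hSc : S.card = r) {K : Type*} [Field K]
    (hM : Relax.Representable M K) :
    ∃ u : Fin n → Fin r → K, ∀ S : Finset (Fin n),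
      M.Indep (h '' S) ↔ LinearIndepOn K u (S : Set (Fin n)) := by
  have hfin : M.E.Finite := hh.range_eq ▸ finite_range h
  obtain ⟨v, hv⟩ := hM.exists_represents_fin hfin (hh.isBase hS hSc)
  have hc : (h '' (S : Set (Fin n))).ncard = r := by
    rw [ncard_image_of_injective _ hh.injective, ncard_coe_finset, hSc]
  have key : ∀ m (v : α → (Fin m → K)), m = r → Represents K M v →
    ∃ u : Fin n → Fin r → K, ∀ S : Finset (Fin n),
      M.Indep (h '' S) ↔ LinearIndepOn K u (S : Set (Fin n)) := by
    rintro m v rfl hv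
    refine ⟨v ∘ h, fun S => ?_⟩
    rw [hv _ (hh.range_eq ▸ image_subset_range h _)]
    exact linearIndepOn_image_iff hh.injective
  exact key _ v hc hv

lemma exists_labelling {K : Type*} [Field K] {c : Fin n → Fin r → K} {g : α → Fin n}
    (hg : BijOn g M.E univ)
    (hM : ∀ I ⊆ M.E, (M.Indep I ↔ LinearIndependent K (fun x : I => c (g (x : α))))) :
    ∃ h : Fin n → α, IsLabelling M h r ∧ ∀ S : Finset (Fin n),
      M.Indep (h '' S) ↔ LinearIndepOn K c (S : Set (Fin n)) := by
  choose h hhE hgh using fun i => hg.surjOn (mem_univ i)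
  have hinj : Function.Injective h := fun i j hij => by rw [← hgh i, ← hgh j, hij]
  have key : ∀ S : Finset (Fin n), M.Indep (h '' S) ↔ LinearIndepOn K c (S : Set (Fin n)) := by
    intro S
    rw [hM _ (by rintro _ ⟨i, -, rfl⟩; exact hhE i)]
    have h1 : (c ∘ g) ∘ h = c := by ext1 i; simp [hgh]
    refine (linearIndepOn_image_iff (v := c ∘ g) hinj).trans ?_
    rw [h1]
  refine ⟨h, ⟨hinj, ?_, fun S hS => ((key S).1 hS).card_le⟩, key⟩
  refine Subset.antisymm (by rintro _ ⟨i, rfl⟩; exact hhE i) fun e he => ⟨g e, ?_⟩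
  exact hg.injOn (hhE _) he (hgh _)

lemma IsLabelling.exists_circuitHyperplane {h : Fin n → α} (hh : IsLabelling M h r)
    {S : Finset (Fin n)} (hS : M.Indep (h '' S)) (hSc : S.card = r) {X : Set α}
    (hX : Relax.CircuitHyperplane M X) :
    ∃ A : Finset (Fin n), X = h '' A ∧ A.card = r ∧ ¬ M.Indep (h '' A) := by
  obtain ⟨A, rfl⟩ := exists_eq_image_finset (hX.subset_ground.trans hh.range_eq.ge)
  refine ⟨A, rfl, ?_, hX.1.1.not_indep⟩
  have := hX.ncard_eq (hh.isBase hS hSc)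
  rw [ncard_image_of_injective _ hh.injective, ncard_image_of_injective _ hh.injective,
    ncard_coe_finset, ncard_coe_finset] at this
  omega

end Labelling

section Tables

/-- The determinant of a matrix with three rows. -/
def detThree {R : Type*} [CommRing R] (a b c : Fin 3 → R) : R :=
  a 0 * (b 1 * c 2 - b 2 * c 1) - a 1 * (b 0 * c 2 - b 2 * c 0) + a 2 * (b 0 * c 1 - b 1 * c 0)

/-- The determinant of a matrix with four rows. -/
def detFour {R : Type*} [CommRing R] (a b c d : Fin 4 → R) : R :=
  (a 0 * b 1 - a 1 * b 0) * (c 2 * d 3 - c 3 * d 2)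
    - (a 0 * b 2 - a 2 * b 0) * (c 1 * d 3 - c 3 * d 1)
    + (a 0 * b 3 - a 3 * b 0) * (c 1 * d 2 - c 2 * d 1)
    + (a 1 * b 2 - a 2 * b 1) * (c 0 * d 3 - c 3 * d 0)
    - (a 1 * b 3 - a 3 * b 1) * (c 0 * d 2 - c 2 * d 0)
    + (a 2 * b 3 - a 3 * b 2) * (c 0 * d 1 - c 1 * d 0)

lemma det_three_rows {R : Type*} [CommRing R] (a b c : Fin 3 → R) :
    Matrix.det (Matrix.of ![a, b, c]) = detThree a b c := by
  rw [Matrix.det_fin_three]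
  simp [detThree]
  ring

lemma det_four_rows {R : Type*} [CommRing R] (a b c d : Fin 4 → R) :
    Matrix.det (Matrix.of ![a, b, c, d]) = detFour a b c d := by
  simp [Matrix.det_succ_row_zero, Fin.sum_univ_succ, detFour, Fin.succAbove]
  ring

/-- The dependent four-element sets of `P₈`. -/
def p8Nonbases : Finset (Finset (Fin 8)) :=
  {{0, 1, 2, 7}, {0, 1, 3, 6}, {0, 2, 3, 5}, {0, 3, 4, 7}, {0, 4, 5, 6}, {1, 2, 3, 4},
    {1, 2, 5, 6}, {1, 4, 5, 7}, {2, 4, 6, 7}, {3, 5, 6, 7}}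

/-- The lines of the non-Fano matroid. -/
def f7Nonbases : Finset (Finset (Fin 7)) :=
  {{0, 1, 3}, {0, 2, 4}, {1, 2, 5}, {0, 5, 6}, {1, 4, 6}, {2, 3, 6}}

set_option synthInstance.maxSize 4000 in
set_option synthInstance.maxHeartbeats 400000 in
lemma detFour_p8cols : ∀ i j : Fin 8, i < j → ∀ k, j < k → ∀ l, k < l →
    (detFour (Relax.P8cols i) (Relax.P8cols j) (Relax.P8cols k) (Relax.P8cols l) ≠ 0 ↔
      ({i, j, k, l} : Finset (Fin 8)) ∉ p8Nonbases) := by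
  decide +kernel

set_option synthInstance.maxSize 4000 in
set_option synthInstance.maxHeartbeats 400000 in
lemma detThree_f7cols : ∀ i j : Fin 7, i < j → ∀ k, j < k →
    (detThree (Relax.F7cols i) (Relax.F7cols j) (Relax.F7cols k) ≠ 0 ↔
      ({i, j, k} : Finset (Fin 7)) ∉ f7Nonbases) := by
  decide +kernel

lemma exists_strictMono_triple {n : ℕ} {S : Finset (Fin n)} (hS : S.card = 3) :
    ∃ z : Fin 3 → Fin n, StrictMono z ∧ S = {z 0, z 1, z 2} := by
  refine ⟨S.orderEmbOfFin hS, (S.orderEmbOfFin hS).strictMono, ?_⟩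
  conv_lhs => rw [← Finset.image_orderEmbOfFin_univ S hS]
  generalize ⇑(S.orderEmbOfFin hS) = f
  ext x
  simp [Fin.exists_fin_succ, eq_comm (a := x)]

lemma exists_strictMono_quadruple {n : ℕ} {S : Finset (Fin n)} (hS : S.card = 4) :
    ∃ z : Fin 4 → Fin n, StrictMono z ∧ S = {z 0, z 1, z 2, z 3} := by
  refine ⟨S.orderEmbOfFin hS, (S.orderEmbOfFin hS).strictMono, ?_⟩
  conv_lhs => rw [← Finset.image_orderEmbOfFin_univ S hS]
  generalize ⇑(S.orderEmbOfFin hS) = f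
  ext x
  simp [Fin.exists_fin_succ, eq_comm (a := x)]

lemma linearIndepOn_p8cols_iff {S : Finset (Fin 8)} (hS : S.card = 4) :
    LinearIndepOn (ZMod 3) Relax.P8cols (S : Set (Fin 8)) ↔ S ∉ p8Nonbases := by
  obtain ⟨z, hz, rfl⟩ := exists_strictMono_quadruple hS
  have h01 : z 0 < z 1 := hz (by decide)
  have h12 : z 1 < z 2 := hz (by decide)
  have h23 : z 2 < z 3 := hz (by decide)
  rw [linearIndepOn_quadruple_iff h01.ne (h01.trans h12).ne ((h01.trans h12).trans h23).ne h12.ne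
    (h12.trans h23).ne h23.ne, det_four_rows]
  exact detFour_p8cols _ _ h01 _ h12 _ h23

lemma linearIndepOn_f7cols_iff {S : Finset (Fin 7)} (hS : S.card = 3) :
    LinearIndepOn ℚ Relax.F7cols (S : Set (Fin 7)) ↔ S ∉ f7Nonbases := by
  obtain ⟨z, hz, rfl⟩ := exists_strictMono_triple hS
  have h01 : z 0 < z 1 := hz (by decide)
  have h12 : z 1 < z 2 := hz (by decide)
  rw [linearIndepOn_triple_iff h01.ne (h01.trans h12).ne h12.ne, det_three_rows]
  exact detThree_f7cols _ _ h01 _ h12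

end Tables

section CharTwo

variable {K : Type*} [Field K]

/-- The matroid `P₈` is not representable in characteristic two. -/
lemma false_of_p8_charTwo [CharP K 2] {u : Fin 8 → Fin 4 → K}
    (hu : ∀ S : Finset (Fin 8), S.card = 4 →
      (LinearIndepOn K u (S : Set (Fin 8)) ↔ S ∉ p8Nonbases)) : False := by
  obtain ⟨w, hw, hwu⟩ := exists_standard_coordinates (u := u) (z := ![0, 1, 2, 3])
    (by decide) (by
      have : range ![(0 : Fin 8), 1, 2, 3] = (({0, 1, 2, 3} : Finset (Fin 8)) : Set (Fin 8)) := by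
        ext x; simp [eq_comm (a := x)]; tauto
      rw [this]
      exact (hu _ (by decide)).2 (by decide))
  have h0 : w 0 = Pi.single 0 1 := hw 0
  have h1 : w 1 = Pi.single 1 1 := hw 1
  have h2 : w 2 = Pi.single 2 1 := hw 2
  have h3 : w 3 = Pi.single 3 1 := hw 3
  have key : ∀ i j k l : Fin 8, i < j → j < k → k < l →
      (detFour (w i) (w j) (w k) (w l) ≠ 0 ↔ ({i, j, k, l} : Finset (Fin 8)) ∉ p8Nonbases) := by
    intro i j k l hij hjk hkl
    have hik := hij.trans hjk
    have hil := hik.trans hkl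
    have hjl := hjk.trans hkl
    rw [← det_four_rows, ← linearIndepOn_quadruple_iff hij.ne hik.ne hil.ne hjk.ne hjl.ne hkl.ne,
      hwu, hu]
    simp [Finset.card_insert_of_notMem, hij.ne, hik.ne, hil.ne, hjk.ne, hjl.ne, hkl.ne]
  have ind : ∀ i j k l : Fin 8, i < j → j < k → k < l →
      ({i, j, k, l} : Finset (Fin 8)) ∉ p8Nonbases → detFour (w i) (w j) (w k) (w l) ≠ 0 :=
    fun i j k l a b c => (key i j k l a b c).2
  have dep : ∀ i j k l : Fin 8, i < j → j < k → k < l →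
      ({i, j, k, l} : Finset (Fin 8)) ∈ p8Nonbases → detFour (w i) (w j) (w k) (w l) = 0 :=
    fun i j k l a b c d => by
      by_contra h
      exact (key i j k l a b c).1 h d
  have z4 := dep 1 2 3 4 (by decide) (by decide) (by decide) (by decide)
  have z5 := dep 0 2 3 5 (by decide) (by decide) (by decide) (by decide)
  have z6 := dep 0 1 3 6 (by decide) (by decide) (by decide) (by decide)
  have z7 := dep 0 1 2 7 (by decide) (by decide) (by decide) (by decide)
  have d1 := dep 0 3 4 7 (by decide) (by decide) (by decide) (by decide)
  have d2 := dep 1 2 5 6 (by decide) (by decide) (by decide) (by decide)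
  have d3 := dep 3 5 6 7 (by decide) (by decide) (by decide) (by decide)
  have d4 := dep 0 4 5 6 (by decide) (by decide) (by decide) (by decide)
  have d5 := dep 2 4 6 7 (by decide) (by decide) (by decide) (by decide)
  have n41 := ind 0 2 3 4 (by decide) (by decide) (by decide) (by decide)
  have n42 := ind 0 1 3 4 (by decide) (by decide) (by decide) (by decide)
  have n43 := ind 0 1 2 4 (by decide) (by decide) (by decide) (by decide)
  have n50 := ind 1 2 3 5 (by decide) (by decide) (by decide) (by decide)
  have n52 := ind 0 1 3 5 (by decide) (by decide) (by decide) (by decide)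
  have n53 := ind 0 1 2 5 (by decide) (by decide) (by decide) (by decide)
  have n60 := ind 1 2 3 6 (by decide) (by decide) (by decide) (by decide)
  have n61 := ind 0 2 3 6 (by decide) (by decide) (by decide) (by decide)
  have n63 := ind 0 1 2 6 (by decide) (by decide) (by decide) (by decide)
  have n70 := ind 1 2 3 7 (by decide) (by decide) (by decide) (by decide)
  have n71 := ind 0 2 3 7 (by decide) (by decide) (by decide) (by decide)
  have n72 := ind 0 1 3 7 (by decide) (by decide) (by decide) (by decide)
  simp [detFour, h0, h1, h2, h3] at z4 z5 z6 z7 d1 d2 d3 d4 d5 n41 n42 n43 n50 n52 n53 n60 n61 n63 n70 n71 n72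
  have two : (2 : K) = 0 := CharTwo.two_eq_zero
  obtain ⟨p, hp⟩ : ∃ p, w 6 1 = p * (w 6 0 * w 4 1) := ⟨w 6 1 / (w 6 0 * w 4 1), by field_simp⟩
  obtain ⟨q, hq⟩ : ∃ q, w 7 1 = q * (w 7 0 * w 4 1) := ⟨w 7 1 / (w 7 0 * w 4 1), by field_simp⟩
  obtain ⟨r, hr⟩ : ∃ r, w 5 2 = r * (w 5 0 * w 4 2) := ⟨w 5 2 / (w 5 0 * w 4 2), by field_simp⟩
  obtain ⟨t, ht⟩ : ∃ t, w 5 3 = t * (w 5 0 * w 4 3) := ⟨w 5 3 / (w 5 0 * w 4 3), by field_simp⟩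
  have hs : w 7 2 = q * (w 7 0 * w 4 2) := by
    refine mul_left_cancel₀ n41 ?_
    linear_combination d1 + w 4 2 * hq
  have hv : w 6 3 = t * (w 6 0 * w 4 3) := by
    refine mul_left_cancel₀ n50 ?_
    linear_combination d2 + w 6 0 * ht
  have hp0 : p ≠ 0 := by rintro rfl; exact n61 (by simpa using hp)
  have hr0 : r ≠ 0 := by rintro rfl; exact n52 (by simpa using hr)
  have hq0 : q ≠ 0 := by rintro rfl; exact n71 (by simpa using hq)
  rw [z5, z6, hp, hq, hr, hs] at d3
  rw [z5, z6, hp, hr, ht, hv] at d4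
  rw [z4, z7, hp, hq, hv] at d5
  have e3 : p * q + q * r = p * r := by
    refine mul_left_cancel₀ (a := w 5 0 * w 6 0 * w 7 0 * w 4 1 * w 4 2) (by positivity) ?_
    linear_combination -d3
  have e4 : r * t + p * t = p * r := by
    refine mul_left_cancel₀ (a := w 5 0 * w 6 0 * w 4 1 * w 4 2 * w 4 3) (by positivity) ?_
    linear_combination d4
  have e5 : q + t = p := by
    refine mul_left_cancel₀ (a := w 6 0 * w 7 0 * w 4 1 * w 4 3) (by positivity) ?_
    linear_combination d5
  have hpr : p + r ≠ 0 := fun h => mul_ne_zero hp0 hr0 (by linear_combination -e4 + t * h)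
  have hqt : q = t := mul_right_cancel₀ hpr (by linear_combination e3 - e4)
  exact hp0 (by linear_combination -e5 - hqt + q * two)

/-- The non-Fano matroid is not representable in characteristic two. -/
lemma false_of_f7_charTwo [CharP K 2] {u : Fin 7 → Fin 3 → K}
    (hu : ∀ S : Finset (Fin 7), S.card = 3 →
      (LinearIndepOn K u (S : Set (Fin 7)) ↔ S ∉ f7Nonbases)) : False := by
  obtain ⟨w, hw, hwu⟩ := exists_standard_coordinates (u := u) (z := ![0, 1, 2])
    (by decide) (by
      have : range ![(0 : Fin 7), 1, 2] = (({0, 1, 2} : Finset (Fin 7)) : Set (Fin 7)) := by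
        ext x; simp [eq_comm (a := x)]; tauto
      rw [this]
      exact (hu _ (by decide)).2 (by decide))
  have h0 : w 0 = Pi.single 0 1 := hw 0
  have h1 : w 1 = Pi.single 1 1 := hw 1
  have h2 : w 2 = Pi.single 2 1 := hw 2
  have key : ∀ i j k : Fin 7, i < j → j < k →
      (detThree (w i) (w j) (w k) ≠ 0 ↔ ({i, j, k} : Finset (Fin 7)) ∉ f7Nonbases) := by
    intro i j k hij hjk
    have hik := hij.trans hjk
    rw [← det_three_rows, ← linearIndepOn_triple_iff hij.ne hik.ne hjk.ne, hwu, hu]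
    simp [Finset.card_insert_of_notMem, hij.ne, hik.ne, hjk.ne]
  have ind : ∀ i j k : Fin 7, i < j → j < k →
      ({i, j, k} : Finset (Fin 7)) ∉ f7Nonbases → detThree (w i) (w j) (w k) ≠ 0 :=
    fun i j k a b => (key i j k a b).2
  have dep : ∀ i j k : Fin 7, i < j → j < k →
      ({i, j, k} : Finset (Fin 7)) ∈ f7Nonbases → detThree (w i) (w j) (w k) = 0 :=
    fun i j k a b d => by
      by_contra h
      exact (key i j k a b).1 h d
  have z3 := dep 0 1 3 (by decide) (by decide) (by decide)
  have z4 := dep 0 2 4 (by decide) (by decide) (by decide)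
  have z5 := dep 1 2 5 (by decide) (by decide) (by decide)
  have d0 := dep 0 5 6 (by decide) (by decide) (by decide)
  have d1 := dep 1 4 6 (by decide) (by decide) (by decide)
  have d2 := dep 2 3 6 (by decide) (by decide) (by decide)
  have n60 := ind 1 2 6 (by decide) (by decide) (by decide)
  have n61 := ind 0 2 6 (by decide) (by decide) (by decide)
  have n62 := ind 0 1 6 (by decide) (by decide) (by decide)
  have n := ind 3 4 5 (by decide) (by decide) (by decide)
  have two : (2 : K) = 0 := CharTwo.two_eq_zero
  simp [detThree, h0, h1, h2] at z3 z4 z5 d0 d1 d2 n60 n61 n62 n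
  refine n ?_
  rw [z3, z4, z5]
  refine (mul_eq_zero.1 (?_ : (w 6 0 * w 6 1 * w 6 2) * _ = 0)).resolve_left (by positivity)
  linear_combination -(w 4 2 * w 6 0 * (w 5 1 * w 6 2)) * d2 - (w 3 1 * w 6 0 * (w 5 1 * w 6 2)) * d1
    - (w 3 1 * w 6 0 * (w 4 0 * w 6 2)) * d0
    - (w 3 1 * w 4 0 * w 5 2 * (w 6 0 * w 6 1 * w 6 2)) * two

end CharTwo

section Nonbases

variable {α : Type*} {n r : ℕ} {M N : Matroid α} {h : Fin n → α} {F : Finset (Finset (Fin n))}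

/-- The matroid `M`, with elements labelled by `h`, has rank at most `r`, and its dependent sets of
size `r` are the members of `F` of this size. -/
structure HasNonbases (M : Matroid α) (h : Fin n → α) (r : ℕ) (F : Finset (Finset (Fin n))) :
    Prop extends IsLabelling M h r where
  indep_iff : ∀ S : Finset (Fin n), S.card = r → (M.Indep (h '' S) ↔ S ∉ F)

lemma HasNonbases.exists_vectors (hM : HasNonbases M h r F) {K : Type*} [Field K]
    (hK : Relax.Representable M K) {S : Finset (Fin n)} (hSc : S.card = r) (hS : S ∉ F) :
    ∃ u : Fin n → Fin r → K, ∀ S : Finset (Fin n), S.card = r →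
      (LinearIndepOn K u (S : Set (Fin n)) ↔ S ∉ F) := by
  obtain ⟨u, hu⟩ := hM.toIsLabelling.exists_vectors ((hM.indep_iff S hSc).2 hS) hSc hK
  exact ⟨u, fun T hT => by rw [← hu, hM.indep_iff T hT]⟩

lemma HasNonbases.comp {σ : Fin n → Fin n} (hM : HasNonbases M h r (F.image (Finset.image σ)))
    (hσ : Function.Injective σ) : HasNonbases M (h ∘ σ) r F where
  injective := hM.injective.comp hσ
  range_eq := by rw [(Finite.surjective_of_injective hσ).range_comp, hM.range_eq]
  card_le S hS := by
    have := hM.card_le (S.image σ) (by rwa [Finset.coe_image, ← image_comp])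
    rwa [Finset.card_image_of_injective _ hσ] at this
  indep_iff S hS := by
    have := hM.indep_iff (S.image σ) (by rwa [Finset.card_image_of_injective _ hσ])
    rw [Finset.coe_image, ← image_comp] at this
    rw [this, (Finset.image_injective hσ).mem_finset_image]

lemma HasNonbases.of_relaxedAt {Y : Set α} (hM : HasNonbases M h r F) (hY : RelaxedAt N M Y) :
    ∃ Z : Finset (Fin n), Y = h '' Z ∧ HasNonbases N h r (insert Z F) := by
  obtain ⟨Z, rfl⟩ := exists_eq_image_finset (hY.subset_ground.trans hM.range_eq.ge)
  refine ⟨Z, rfl, ⟨⟨hM.injective, hM.range_eq.trans hY.ground_eq.symm, fun S hS =>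
    hM.card_le S ((hY.indep_iff _).2 (.inl hS))⟩, fun S hS => ?_⟩⟩
  have h1 := hM.indep_iff S hS
  rw [hY.indep_iff, image_finset_injective hM.injective] at h1
  rw [Finset.mem_insert, not_or, ← h1]
  refine ⟨fun h2 => ⟨?_, .inl h2⟩, fun h2 => h2.2.resolve_right h2.1⟩
  rintro rfl
  exact hY.not_indep h2

lemma HasNonbases.relaxation {X : Set α} (hN : HasNonbases N h r F)
    (hX : Relax.IsRelaxation N M X) {S : Finset (Fin n)} (hSc : S.card = r) (hS : S ∉ F) :
    ∃ A ∈ F, X = h '' A ∧ HasNonbases M h r (F.erase A) := by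
  obtain ⟨A, rfl, hAc, hA⟩ := hN.toIsLabelling.exists_circuitHyperplane
    ((hN.indep_iff S hSc).2 hS) hSc hX.1
  have hrel := hX.relaxedAt
  refine ⟨A, ?_, rfl, ⟨⟨hN.injective, hN.range_eq.trans hrel.ground_eq, fun T hT => ?_⟩,
    fun T hT => ?_⟩⟩
  · by_contra h1
    exact hA ((hN.indep_iff A hAc).2 h1)
  · rcases (hrel.indep_iff _).1 hT with h1 | h1
    · exact hN.card_le T h1
    · rw [image_finset_injective hN.injective] at h1
      rw [h1, hAc]
  · rw [hrel.indep_iff, image_finset_injective hN.injective, hN.indep_iff T hT, Finset.mem_erase]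
    tauto

/-- A ternary matroid has no five-point line minor. -/
lemma HasNonbases.exists_union_mem (hM : HasNonbases M h r F)
    (h₃ : Relax.Representable M (ZMod 3)) (I J : Finset (Fin n)) (hJ : 4 < J.card)
    (hIJ : Disjoint I J) (hI : I.card + 2 = r) : ∃ T ∈ J.powersetCard 2, I ∪ T ∈ F := by
  by_contra! hF
  have hc : ∀ T ⊆ J, (I ∪ T).card = I.card + T.card := fun T hT =>
    Finset.card_union_of_disjoint (hIJ.mono_right hT)
  obtain ⟨T, hT⟩ : (J.powersetCard 2).Nonempty := Finset.powersetCard_nonempty.2 (by omega)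
  have hT' := Finset.mem_powersetCard.1 hT
  obtain ⟨u, hu⟩ := hM.exists_vectors h₃ (by rw [hc T hT'.1, hT'.2, hI]) (hF T hT)
  refine false_of_ternary_line_minor hJ hIJ (u := u) (fun T hT hTc => ?_) fun T hT hTc hli => ?_
  · rw [hu _ (by rw [hc T hT, hTc, hI])]
    exact hF T (Finset.mem_powersetCard.2 ⟨hT, hTc⟩)
  · have := hli.card_le
    rw [hc T hT] at this
    omega

lemma detThree_plucker {R : Type*} [CommRing R] (x y l m a : Fin 3 → R) :
    detThree x y l * detThree x m a - detThree x y m * detThree x l a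
      = detThree x y a * detThree x m l := by
  simp only [detThree]
  ring

/-- Two lines meeting in two points are equal. -/
lemma mem_of_line_eq {K : Type*} [Field K] {u : Fin n → Fin 3 → K}
    (hu : ∀ S : Finset (Fin n), S.card = 3 → (LinearIndepOn K u (S : Set (Fin n)) ↔ S ∉ F))
    (x y l m a : Fin n) (hd : [x, y, l, m, a].Nodup) (hl : {x, y, l} ∈ F) (hm : {x, y, m} ∈ F)
    (ha : {x, y, a} ∉ F) : {x, m, l} ∈ F := by
  have key : ∀ i j k : Fin n, i ≠ j → i ≠ k → j ≠ k →
      (detThree (u i) (u j) (u k) ≠ 0 ↔ ({i, j, k} : Finset (Fin n)) ∉ F) := by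
    intro i j k hij hik hjk
    rw [← det_three_rows, ← linearIndepOn_triple_iff hij hik hjk, hu]
    simp [Finset.card_insert_of_notMem, hij, hik, hjk]
  simp only [List.nodup_cons, List.mem_cons, List.not_mem_nil, or_false, not_or] at hd
  obtain ⟨⟨hxy, hxl, hxm, hxa⟩, ⟨hyl, hym, hya⟩, ⟨hlm, hla⟩, hma, -⟩ := hd
  by_contra hc
  have h1 := (key _ _ _ hxm hxl (Ne.symm hlm)).2 hc
  have h2 := (key _ _ _ hxy hxa hya).2 ha
  have h3 : detThree (u x) (u y) (u l) = 0 := by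
    by_contra h
    exact (key _ _ _ hxy hxl hyl).1 h hl
  have h4 : detThree (u x) (u y) (u m) = 0 := by
    by_contra h
    exact (key _ _ _ hxy hxm hym).1 h hm
  have := detThree_plucker (u x) (u y) (u l) (u m) (u a)
  rw [h3, h4, zero_mul, zero_mul, sub_zero] at this
  exact mul_ne_zero h2 h1 this.symm

end Nonbases

section Excluded

variable {α : Type*} {M N : Matroid α}

set_option synthInstance.maxSize 4000 in
lemma Relax.IsP8Minus.exists_hasNonbases (hM : Relax.IsP8Minus M) :
    ∃ h : Fin 8 → α, HasNonbases M h 4 (p8Nonbases.erase {0, 3, 4, 7}) := by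
  obtain ⟨N, X, Y, ⟨g, hg, hgN⟩, hY, hXY, hX⟩ := hM
  obtain ⟨h, hh, hhN⟩ := exists_labelling hg hgN
  have hN : HasNonbases N h 4 p8Nonbases := ⟨hh, fun S hS => by
    rw [hhN, linearIndepOn_p8cols_iff hS]⟩
  have hb : ({0, 1, 2, 3} : Finset (Fin 8)) ∉ p8Nonbases := by decide
  obtain ⟨A, hA, rfl, hMA⟩ := hN.relaxation hX (by decide) hb
  obtain ⟨B, rfl, hBc, hB⟩ := hh.exists_circuitHyperplane ((hN.indep_iff _ (by decide)).2 hb)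
    (by decide) hY
  rw [hN.indep_iff B hBc, not_not] at hB
  rw [disjoint_image_iff hh.injective, Finset.disjoint_coe] at hXY
  have key : ∀ A ∈ p8Nonbases, ∀ B ∈ p8Nonbases, Disjoint A B →
      A = {0, 3, 4, 7} ∨ A = {1, 2, 5, 6} := by decide +kernel
  rcases key A hA B hB hXY with rfl | rfl
  · exact ⟨h, hMA⟩
  · refine ⟨h ∘ ![1, 0, 3, 2, 5, 4, 7, 6], HasNonbases.comp ?_ (by decide)⟩
    convert hMA using 1
    decide +kernel

set_option synthInstance.maxSize 4000 in
lemma Relax.IsF7Eq.exists_hasNonbases (hM : Relax.IsF7Eq M) :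
    ∃ h : Fin 7 → α, HasNonbases M h 3 (f7Nonbases.erase {0, 1, 3}) := by
  obtain ⟨N, X, ⟨g, hg, hgN⟩, hX⟩ := hM
  obtain ⟨h, hh, hhN⟩ := exists_labelling hg hgN
  have hN : HasNonbases N h 3 f7Nonbases := ⟨hh, fun S hS => by
    rw [hhN, linearIndepOn_f7cols_iff hS]⟩
  have hb : ({0, 1, 2} : Finset (Fin 7)) ∉ f7Nonbases := by decide
  obtain ⟨A, hA, rfl, hMA⟩ := hN.relaxation hX (by decide) hb
  have key : ∀ A ∈ f7Nonbases, ∃ σ ∈ ([id, ![0, 2, 1, 4, 3, 5, 6], ![1, 2, 0, 5, 3, 4, 6],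
      ![0, 6, 1, 5, 3, 4, 2], ![1, 6, 0, 4, 3, 5, 2], ![2, 6, 0, 3, 4, 5, 1]] :
        List (Fin 7 → Fin 7)), Function.Injective σ ∧
      (f7Nonbases.erase {0, 1, 3}).image (Finset.image σ) = f7Nonbases.erase A := by
    decide +kernel
  obtain ⟨σ, -, hσ, hσA⟩ := key A hA
  exact ⟨h ∘ σ, HasNonbases.comp (hσA ▸ hMA) hσ⟩

lemma Relax.IsP8Minus.not_representable_ternary (hM : Relax.IsP8Minus M) :
    ¬ Relax.Representable M (ZMod 3) := by
  intro h₃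
  obtain ⟨h, hh⟩ := hM.exists_hasNonbases
  obtain ⟨T, hT, hTF⟩ := hh.exists_union_mem h₃ {0, 4} {1, 2, 3, 6, 7} (by decide) (by decide)
    (by decide)
  revert T
  decide +kernel

lemma Relax.IsF7Eq.not_representable_ternary (hM : Relax.IsF7Eq M) :
    ¬ Relax.Representable M (ZMod 3) := by
  intro h₃
  obtain ⟨h, hh⟩ := hM.exists_hasNonbases
  obtain ⟨T, hT, hTF⟩ := hh.exists_union_mem h₃ {3} {0, 1, 2, 4, 5} (by decide) (by decide)
    (by decide)
  revert T
  decide +kernel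

set_option synthInstance.maxSize 4000 in
lemma Relax.IsP8Minus.not_relaxedAt (hM : Relax.IsP8Minus M) {Y : Set α} (hY : RelaxedAt N M Y)
    (h₃ : Relax.Representable N (ZMod 3)) (h₄ : Relax.Representable N Relax.GF4) : False := by
  obtain ⟨h, hh⟩ := hM.exists_hasNonbases
  obtain ⟨Z, -, hZ⟩ := hh.of_relaxedAt hY
  obtain ⟨T, hT, hTF⟩ := hZ.exists_union_mem h₃ {0, 4} {1, 2, 3, 6, 7} (by decide) (by decide)
    (by decide)
  obtain ⟨T', hT', hTF'⟩ := hZ.exists_union_mem h₃ {3, 7} {0, 1, 2, 4, 6} (by decide) (by decide)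
    (by decide)
  have key : ∀ T ∈ Finset.powersetCard 2 ({1, 2, 3, 6, 7} : Finset (Fin 8)),
      {0, 4} ∪ T ∉ p8Nonbases.erase {0, 3, 4, 7} ∧
      ∀ T' ∈ Finset.powersetCard 2 ({0, 1, 2, 4, 6} : Finset (Fin 8)),
        {3, 7} ∪ T' ∉ p8Nonbases.erase {0, 3, 4, 7} ∧
        ({0, 4} ∪ T = {3, 7} ∪ T' → {0, 4} ∪ T = {0, 3, 4, 7}) := by
    decide +kernel
  have h1 := (Finset.mem_insert.1 hTF).resolve_right (key T hT).1
  have h2 := (Finset.mem_insert.1 hTF').resolve_right ((key T hT).2 T' hT').1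
  have h3 := ((key T hT).2 T' hT').2 (h1.trans h2.symm)
  rw [← h1, h3, Finset.insert_erase (by decide)] at hZ
  obtain ⟨u, hu⟩ := hZ.exists_vectors h₄ (S := {0, 1, 2, 3}) (by decide) (by decide)
  exact false_of_p8_charTwo hu

lemma HasNonbases.false_of_f7 {h : Fin 7 → α} (hN : HasNonbases N h 3 f7Nonbases)
    (h₄ : Relax.Representable N Relax.GF4) : False := by
  obtain ⟨u, hu⟩ := hN.exists_vectors h₄ (S := {0, 1, 2}) (by decide) (by decide)
  exact false_of_f7_charTwo hu

set_option synthInstance.maxSize 4000 in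
lemma Relax.IsF7Eq.not_relaxedAt (hM : Relax.IsF7Eq M) {Y : Set α} (hY : RelaxedAt N M Y)
    (h₃ : Relax.Representable N (ZMod 3)) (h₄ : Relax.Representable N Relax.GF4) : False := by
  obtain ⟨h, hh⟩ := hM.exists_hasNonbases
  obtain ⟨Z, -, hZ⟩ := hh.of_relaxedAt hY
  obtain ⟨T, hT, hTF⟩ := hZ.exists_union_mem h₃ {3} {0, 1, 2, 4, 5} (by decide) (by decide)
    (by decide)
  obtain ⟨T', hT', hTF'⟩ := hZ.exists_union_mem h₃ {3} {0, 1, 4, 5, 6} (by decide) (by decide)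
    (by decide)
  have key : ∀ T ∈ Finset.powersetCard 2 ({0, 1, 2, 4, 5} : Finset (Fin 7)),
      {3} ∪ T ∉ f7Nonbases.erase {0, 1, 3} ∧
      ∀ T' ∈ Finset.powersetCard 2 ({0, 1, 4, 5, 6} : Finset (Fin 7)),
        {3} ∪ T' ∉ f7Nonbases.erase {0, 1, 3} ∧
        ({3} ∪ T = {3} ∪ T' → {3} ∪ T ∈ ({{0, 1, 3}, {3, 4, 5}, {0, 4, 3}, {0, 5, 3}, {1, 4, 3},
          {1, 5, 3}} : Finset (Finset (Fin 7)))) := by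
    decide +kernel
  have h1 := (Finset.mem_insert.1 hTF).resolve_right (key T hT).1
  have h2 := (Finset.mem_insert.1 hTF').resolve_right ((key T hT).2 T' hT').1
  have h3 := ((key T hT).2 T' hT').2 (h1.trans h2.symm)
  rw [h1] at h3
  have line : ∀ x y l a : Fin 7, ({x, y, 3} : Finset (Fin 7)) = Z → [x, y, l, 3, a].Nodup →
      ({x, y, l} : Finset (Fin 7)) ∈ insert ({x, y, 3} : Finset (Fin 7))
        (f7Nonbases.erase {0, 1, 3}) →
      ({x, y, a} : Finset (Fin 7)) ∉ insert ({x, y, 3} : Finset (Fin 7))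
        (f7Nonbases.erase {0, 1, 3}) →
      ({x, 3, l} : Finset (Fin 7)) ∉ insert ({x, y, 3} : Finset (Fin 7))
        (f7Nonbases.erase {0, 1, 3}) → False := by
    rintro x y l a rfl hd hl ha hc
    obtain ⟨u, hu⟩ := hZ.exists_vectors h₃ (S := {x, y, a}) (by
      simp only [List.nodup_cons, List.mem_cons, not_or] at hd
      exact Finset.card_eq_three.2 ⟨x, y, a, hd.1.1, hd.1.2.2.2.1, hd.2.1.2.2.1, rfl⟩) ha
    exact hc (mem_of_line_eq hu x y l 3 a hd hl (Finset.mem_insert_self _ _) ha)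
  simp only [Finset.mem_insert, Finset.mem_singleton] at h3
  rcases h3 with rfl | rfl | rfl | rfl | rfl | rfl
  · rw [Finset.insert_erase (by decide)] at hZ
    exact hZ.false_of_f7 h₄
  · refine HasNonbases.false_of_f7 (h := h ∘ ![4, 5, 2, 3, 0, 1, 6])
      (HasNonbases.comp ?_ (by decide)) h₄
    convert hZ using 1
    decide +kernel
  · exact line 0 4 2 1 rfl (by decide) (by decide) (by decide) (by decide)
  · exact line 0 5 6 1 rfl (by decide) (by decide) (by decide) (by decide)
  · exact line 1 4 6 0 rfl (by decide) (by decide) (by decide) (by decide)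
  · exact line 1 5 2 0 rfl (by decide) (by decide) (by decide) (by decide)

lemma RelaxedAt.not_excluded_minor {M' : Matroid α} {X : Set α} (hfin : M.E.Finite)
    (h : RelaxedAt M M' X) (h' : RelaxedAt M✶ M'✶ (M.E \ X))
    (h₃ : Relax.Representable M (ZMod 3)) (h₄ : Relax.Representable M Relax.GF4) {C D : Set α}
    (hC : C ⊆ M'.E) :
    ¬ (Relax.IsP8Minus ((M' ／ C) ＼ D) ∨ Relax.IsF7Eq ((M' ／ C) ＼ D)) := by
  rcases h.minor_cases hfin h' h₃ h₄ hC (D := D) with h₀ | ⟨N, Y, hY, hN₃, hN₄⟩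
  · rintro (h1 | h1)
    · exact h1.not_representable_ternary h₀
    · exact h1.not_representable_ternary h₀
  · rintro (h1 | h1)
    · exact h1.not_relaxedAt hY hN₃ hN₄
    · exact h1.not_relaxedAt hY hN₃ hN₄

end Excluded

/-- Let `M` and `M'` be 3-connected GF(4)-representable (finite) matroids
such that `M'` is obtained from `M` by relaxing a circuit-hyperplane `X`. Then `M'` has no
minor isomorphic to `P₈⁻`, `F₇⁼`, or `(F₇⁼)✶`. -/
theorem statement10 {α : Type*} (M M' : Matroid α) (X : Set α)
    (hfin : M.E.Finite)
    (hrepM : Relax.Representable M Relax.GF4)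
    (hrepM' : Relax.Representable M' Relax.GF4)
    (h3cM : Relax.ThreeConnected M) (h3cM' : Relax.ThreeConnected M')
    (hrel : Relax.IsRelaxation M M' X) :
    ¬ ∃ M₀ : Matroid α, Relax.MinorOf M₀ M' ∧
        (Relax.IsP8Minus M₀ ∨ Relax.IsF7Eq M₀ ∨ Relax.IsF7Eq M₀✶) := by
  have h := hrel.relaxedAt
  have h' := hrel.relaxedAt_dual hfin
  have h₃ := hrel.representable_ternary hfin hrepM hrepM'
  rintro ⟨_, ⟨C, D, hC, hD, hCD, rfl⟩, h0⟩
  change Relax.IsP8Minus ((M' ／ C) ＼ D) ∨ Relax.IsF7Eq ((M' ／ C) ＼ D) ∨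
    Relax.IsF7Eq ((M' ／ C) ＼ D)✶ at h0
  rw [← or_assoc] at h0
  refine h0.elim (h.not_excluded_minor hfin h' h₃ hrepM hC) fun h1 => ?_
  rw [dual_delete, dual_contract, ← contract_delete_comm _ hCD.symm] at h1
  refine RelaxedAt.not_excluded_minor (M := M✶) (M' := M'✶) (X := M.E \ X) hfin h' ?_
    (h₃.dual hfin) (hrepM.dual hfin) (C := D) (D := C) hD (.inr h1)
  rwa [dual_dual, dual_dual, dual_ground, sdiff_sdiff_right_self,
    inter_eq_self_of_subset_right (h.ground_eq ▸ h.subset_ground)]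
end

section
/- With M, X, e, f, C, A, M', C', A' and ω as in the setup, no entry of A' equals ω + 1; that is, every entry of A' lies in {0, 1, ω}. -/
open Matroid Set
open scoped Classical

namespace Relax

variable {α : Type*}

lemma GF4.pow_four (x : GF4) : x ^ 4 = x := by
  have : Fintype GF4 := Fintype.ofFinite _
  have hcard : Fintype.card GF4 = 4 := by
    rw [← Nat.card_eq_fintype_card, GaloisField.card 2 2 two_ne_zero]
    norm_num
  simpa [hcard] using FiniteField.pow_card x

lemma GF4.sq_add_self {x : GF4} (h0 : x ≠ 0) (h1 : x ≠ 1) : x ^ 2 + x + 1 = 0 := by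
  have h : x * (x - 1) * (x ^ 2 + x + 1) = 0 := by linear_combination GF4.pow_four x
  simpa [h0, sub_eq_zero, h1] using h

lemma GF4.two_eq_zero : (2 : GF4) = 0 := CharTwo.two_eq_zero

/-- If `w ∉ {0, 1}` then `GF(4) = {0, 1, w, w + 1}`. -/
lemma GF4.mem_of_ne {w : GF4} (h0 : w ≠ 0) (h1 : w ≠ 1) {x : GF4} (hx : x ≠ w + 1) :
    x ∈ ({0, 1, w} : Set GF4) := by
  by_contra h
  simp only [mem_insert_iff, mem_singleton_iff, not_or] at h
  obtain ⟨hx0, hx1, hxw⟩ := h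
  have h : (x - w) * (x - (w + 1)) = 0 := by
    linear_combination GF4.sq_add_self hx0 hx1 + GF4.sq_add_self h0 h1 -
      (x * w + x + 1) * GF4.two_eq_zero
  simp [sub_eq_zero, hxw, hx] at h

/-- Exchanging an element of a circuit-hyperplane for an element outside it gives an
independent set. -/
lemma CircuitHyperplane.insert_diff_indep {M : Matroid α} {X : Set α}
    (h : CircuitHyperplane M X) {i j : α} (hi : i ∈ X) (hj : j ∈ M.E \ X) :
    M.Indep (insert j (X \ {i})) := by
  have hI : M.Indep (X \ {i}) := h.1.2 _ (sdiff_singleton_ssubset.2 hi)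
  refine (hI.insert_indep_iff).2 (.inl ⟨hj.1, fun hmem => hj.2 ?_⟩)
  rw [← h.2.1.closure]
  exact M.closure_subset_closure sdiff_subset hmem

/-- Independent sets stay independent under relaxation. -/
lemma IsRelaxation.indep {M M' : Matroid α} {X I : Set α} (h : IsRelaxation M M' X)
    (hI : M.Indep I) : M'.Indep I := by
  obtain ⟨B, hB, hIB⟩ := hI.exists_isBase_superset
  exact ((h.2.2 B).2 (.inl hB)).indep.subset hIB

section colVec

variable {X : Set α} {e f : α} {A : α → α → GF4} {w : GF4}

lemma colVec_of_mem (r : (X \ {e} ∪ {f} : Set α)) :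
    colVec X e f A w r = Pi.single r 1 := by
  ext s
  simp only [colVec, if_pos r.2, Pi.single_apply, Subtype.ext_iff]

lemma colVec_self (he : e ∈ X) (hf : f ∉ X) (r : (X \ {e} ∪ {f} : Set α)) :
    colVec X e f A w e r = if (r : α) = f then w else 1 := by
  have hef : e ≠ f := fun h => hf (h ▸ he)
  simp [colVec, hef]

lemma colVec_of_notMem (he : e ∈ X) {j : α} (hj : j ∉ X) (hjf : j ≠ f)
    (r : (X \ {e} ∪ {f} : Set α)) :
    colVec X e f A w j r = if (r : α) = f then 1 else A r j := by
  have hje : j ≠ e := fun h => hj (h ▸ he)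
  simp [colVec, hj, hjf, hje]

/-- The columns of `(X \ {i}) ∪ {j}` are dependent when the minor of `C` on rows `i, f` and
columns `j, e` vanishes. -/
lemma not_linearIndependent_colVec (hX : X.Finite) (he : e ∈ X) (hf : f ∉ X) {i j : α}
    (hi : i ∈ X \ {e}) (hj : j ∉ X) (hjf : j ≠ f) (hdet : A i j * w = 1) :
    ¬ LinearIndependent GF4
      (fun x : (insert j (X \ {i}) : Set α) => colVec X e f A w (x : α)) := by
  intro hli
  have : Finite (X \ {e} ∪ {f} : Set α) := (hX.sdiff.union (finite_singleton f)).to_subtype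
  have := Fintype.ofFinite (X \ {e} ∪ {f} : Set α)
  have hje : j ≠ e := fun h => hj (h ▸ he)
  have heI : e ∈ insert j (X \ {i}) := .inr ⟨he, fun h => hi.2 h.symm⟩
  have hli : LinearIndepOn GF4 (colVec X e f A w) (insert j (X \ {i})) := hli
  refine hli.notMem_span heI ?_
  rw [← sub_add_cancel (colVec X e f A w e) (w • colVec X e f A w j)]
  refine add_mem ?_ (Submodule.smul_mem _ _ (Submodule.subset_span ⟨j, ⟨.inl rfl, hje⟩, rfl⟩))
  rw [pi_eq_sum_univ' (colVec X e f A w e - w • colVec X e f A w j)]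
  refine Submodule.sum_mem _ fun r _ => ?_
  by_cases hr : (r : α) = f ∨ (r : α) = i
  · suffices h0 : (colVec X e f A w e - w • colVec X e f A w j) r = 0 by
      rw [h0, zero_smul]
      exact zero_mem _
    simp only [Pi.sub_apply, Pi.smul_apply, smul_eq_mul, colVec_self he hf,
      colVec_of_notMem he hj hjf]
    split_ifs with hrf
    · ring
    · rw [hr.resolve_left hrf]
      linear_combination -hdet
  · rw [not_or] at hr
    refine Submodule.smul_mem _ _ (Submodule.subset_span ⟨r, ?_, ?_⟩)
    · have hrX := r.2.resolve_right hr.1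
      exact ⟨.inr ⟨hrX.1, hr.2⟩, hrX.2⟩
    · rw [colVec_of_mem]

end colVec

end Relax

/-- With `M, X, e, f, C, A, M', C', A'` and `ω` as in the setup, no entry
of `A'` equals `ω + 1`; that is, every entry of `A'` lies in `{0, 1, ω}`. -/
theorem statement12 {α : Type*} (M M' : Matroid α) (X : Set α) (e f : α)
    (A A' : α → α → Relax.GF4) (w : Relax.GF4)
    (hfin : M.E.Finite)
    (hrel : Relax.IsRelaxation M M' X)
    (he : e ∈ X) (hf : f ∈ M.E \ X)
    (hB : M.IsBase (X \ {e} ∪ {f}))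
    (hA : Relax.RepBy M X e f A 0)
    (hw0 : w ≠ 0) (hw1 : w ≠ 1)
    (hA' : Relax.RepBy M' X e f A' w) :
    ∀ i ∈ X \ {e}, ∀ j ∈ (M.E \ X) \ {f},
      A' i j ≠ w + 1 ∧ A' i j ∈ ({0, 1, w} : Set Relax.GF4) := by
  intro i hi j hj
  have hne : A' i j ≠ w + 1 := by
    intro h
    have hI := hrel.1.insert_diff_indep hi.1 hj.1
    have hX : X.Finite := hfin.subset hrel.1.2.1.subset_ground
    refine Relax.not_linearIndependent_colVec hX he hf.2 hi hj.1.2 hj.2 ?_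
      ((hA' _ ?_).1 (hrel.indep hI))
    · rw [h]
      linear_combination Relax.GF4.sq_add_self hw0 hw1 - Relax.GF4.two_eq_zero
    · exact hrel.2.1 ▸ hI.subset_ground
  exact ⟨hne, Relax.GF4.mem_of_ne hw0 hw1 hne⟩
end
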